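/- arXiv:2508.06977 — 10 statements merged into one kernel-verified Lean document; each statement's English description precedes it below -/
import Mathlib

section
/- Let G be a finite simple bipartite graph and let p, q ≥ 1 be integers. Then hom(K_{p,q}, G) ≥ Σ_{w ∈ V(G)} (d_G(w)^p + d_G(w)^q) − 2·|E(G)|. Moreover, if G is C4-free then equality holds for all p, q ≥ 1; and conversely, if p ≥ 2 and q ≥ 2 and equality holds, then G is C4-free. -/
open Finset

/-- `G` contains a cycle of length 4 (as a subgraph): there are four distinct vertices
forming a 4-cycle. -/
def HasC4 {V : Type*} (G : SimpleGraph V) : Prop :=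
  ∃ a b c d : V, a ≠ b ∧ a ≠ c ∧ a ≠ d ∧ b ≠ c ∧ b ≠ d ∧ c ≠ d ∧
    G.Adj a b ∧ G.Adj b c ∧ G.Adj c d ∧ G.Adj d a

/-- `G` is C4-free: it contains no cycle of length 4 as a subgraph. -/
def C4Free {V : Type*} (G : SimpleGraph V) : Prop := ¬ HasC4 G

namespace SimpleGraph

variable {V ι κ : Type*} (G : SimpleGraph V)

/-- Homomorphisms from a complete bipartite graph are pairs of completely joined maps. -/
def completeBipartiteHomEquiv :
    (completeBipartiteGraph ι κ →g G) ≃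
      {x : (ι → V) × (κ → V) // ∀ i j, G.Adj (x.1 i) (x.2 j)} where
  toFun φ := ⟨(fun i => φ (Sum.inl i), fun j => φ (Sum.inr j)),
    fun i j => φ.map_rel (by simp)⟩
  invFun x :=
    { toFun := Sum.elim x.1.1 x.1.2
      map_rel' := by
        rintro (a | a) (b | b) h
        · simp at h
        · exact x.2 a b
        · exact (x.2 b a).symm
        · simp at h }
  left_inv φ := by
    ext (a | a) <;> rfl
  right_inv x := rfl

variable [Fintype V] [DecidableEq V] [DecidableRel G.Adj]
  [Fintype ι] [Fintype κ] [DecidableEq ι] [DecidableEq κ]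

variable (ι κ) in
/-- The pairs of maps into the vertex set whose values are completely joined. -/
def joinedPairs : Finset ((ι → V) × (κ → V)) := {x | ∀ i j, G.Adj (x.1 i) (x.2 j)}

omit [DecidableEq V] in
lemma mem_joinedPairs {x : (ι → V) × (κ → V)} :
    x ∈ G.joinedPairs ι κ ↔ ∀ i j, G.Adj (x.1 i) (x.2 j) := by
  simp [joinedPairs]

omit [DecidableEq V] in
lemma natCard_completeBipartiteHom :
    Nat.card (completeBipartiteGraph ι κ →g G) = #(G.joinedPairs ι κ) := by
  rw [Nat.card_congr G.completeBipartiteHomEquiv, Nat.card_eq_fintype_card, Fintype.card_subtype,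
    joinedPairs]

lemma card_joinedPairs_fst_const [Nonempty ι] :
    #{x ∈ G.joinedPairs ι κ | ∃ w, x.1 = fun _ => w} =
      ∑ w : V, G.degree w ^ Fintype.card κ := by
  have i₀ : ι := Classical.arbitrary ι
  have h : ∀ w : V, G.degree w ^ Fintype.card κ =
      #(Fintype.piFinset fun _ : κ => G.neighborFinset w) := by
    intro w
    simp
  simp_rw [h]
  rw [← card_sigma]
  refine card_bij' (fun x _ => ⟨x.1 i₀, x.2⟩) (fun y _ => (fun _ => y.1, y.2)) ?_ ?_ ?_ ?_
  · simp +contextual [mem_joinedPairs]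
  · rintro ⟨w, g⟩ hg
    exact mem_filter.2 ⟨G.mem_joinedPairs.2 (by simpa using hg), w, rfl⟩
  · rintro ⟨f, g⟩ hx
    obtain ⟨w, rfl⟩ := (mem_filter.1 hx).2
    rfl
  · rintro ⟨w, g⟩ -
    rfl

lemma card_joinedPairs_snd_const [Nonempty κ] :
    #{x ∈ G.joinedPairs ι κ | ∃ w, x.2 = fun _ => w} =
      ∑ w : V, G.degree w ^ Fintype.card ι := by
  rw [← G.card_joinedPairs_fst_const (ι := κ) (κ := ι)]
  refine card_bij' (fun x _ => x.swap) (fun x _ => x.swap) ?_ ?_ ?_ ?_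
  · simp +contextual [mem_joinedPairs, G.adj_comm]
  · simp +contextual [mem_joinedPairs, G.adj_comm]
  · simp
  · simp

lemma card_joinedPairs_both_const [Nonempty ι] [Nonempty κ] :
    #{x ∈ G.joinedPairs ι κ | (∃ w, x.1 = fun _ => w) ∧ ∃ w, x.2 = fun _ => w} =
      2 * #G.edgeFinset := by
  have i₀ : ι := Classical.arbitrary ι
  have j₀ : κ := Classical.arbitrary κ
  rw [← G.dart_card_eq_twice_card_edges, ← card_univ]
  refine card_bij'
    (fun x hx => ⟨(x.1 i₀, x.2 j₀), G.mem_joinedPairs.1 (mem_filter.1 hx).1 i₀ j₀⟩)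
    (fun d _ => (fun _ => d.fst, fun _ => d.snd)) ?_ ?_ ?_ ?_
  · simp
  · rintro d -
    exact mem_filter.2 ⟨G.mem_joinedPairs.2 fun _ _ => d.adj, ⟨_, rfl⟩, ⟨_, rfl⟩⟩
  · rintro ⟨f, g⟩ hx
    obtain ⟨_, ⟨w, hf⟩, ⟨z, hg⟩⟩ := mem_filter.1 hx
    dsimp only at hf hg
    subst hf hg
    rfl
  · rintro d -
    rfl

/-- Inclusion-exclusion over the pairs with a constant component. -/
lemma card_joinedPairs_add [Nonempty ι] [Nonempty κ] :
    #(G.joinedPairs ι κ) + 2 * #G.edgeFinset =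
      ∑ w : V, (G.degree w ^ Fintype.card ι + G.degree w ^ Fintype.card κ) +
        #{x ∈ G.joinedPairs ι κ | ¬ ((∃ w, x.1 = fun _ => w) ∨ ∃ w, x.2 = fun _ => w)} := by
  rw [sum_add_distrib, ← G.card_joinedPairs_fst_const (ι := ι) (κ := κ),
    ← G.card_joinedPairs_snd_const (ι := ι) (κ := κ),
    ← G.card_joinedPairs_both_const (ι := ι) (κ := κ),
    ← card_filter_add_card_filter_not (s := G.joinedPairs ι κ)
      (fun x => (∃ w, x.1 = fun _ => w) ∨ ∃ w, x.2 = fun _ => w),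
    filter_or, filter_and]
  have := card_union_add_card_inter {x ∈ G.joinedPairs ι κ | ∃ w, x.1 = fun _ => w}
    {x ∈ G.joinedPairs ι κ | ∃ w, x.2 = fun _ => w}
  omega

omit [Fintype V] [DecidableEq V] [Fintype ι] [DecidableEq ι] in
lemma exists_ne_of_not_const [Nonempty ι] {f : ι → V} (hf : ¬ ∃ w, f = fun _ => w) :
    ∃ i i', f i ≠ f i' := by
  by_contra! h
  exact hf ⟨f (Classical.arbitrary ι), funext fun i => h _ _⟩

omit [Fintype V] [DecidableEq V] [Fintype ι] [DecidableEq ι] in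
lemma exists_forall_eq_or_eq_of_nontrivial [Nontrivial ι] {a b : V} (hab : a ≠ b) :
    ∃ f : ι → V, (∀ i, f i = a ∨ f i = b) ∧ ¬ ∃ w, f = fun _ => w := by
  classical
  obtain ⟨i, j, hij⟩ := exists_pair_ne ι
  refine ⟨fun k => if k = i then a else b, fun k => by grind, ?_⟩
  rintro ⟨w, hw⟩
  have hi := congrFun hw i
  have hj := congrFun hw j
  grind

lemma hasC4_of_joinedPairs_nonconst_nonempty [Nonempty ι] [Nonempty κ]
    (h : {x ∈ G.joinedPairs ι κ |
      ¬ ((∃ w, x.1 = fun _ => w) ∨ ∃ w, x.2 = fun _ => w)}.Nonempty) : HasC4 G := by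
  obtain ⟨⟨f, g⟩, hx⟩ := h
  rw [mem_filter, mem_joinedPairs, not_or] at hx
  obtain ⟨hadj, hf, hg⟩ := hx
  obtain ⟨i, i', hi⟩ := exists_ne_of_not_const hf
  obtain ⟨j, j', hj⟩ := exists_ne_of_not_const hg
  exact ⟨f i, g j, f i', g j', (hadj i j).ne, hi, (hadj i j').ne, (hadj i' j).ne.symm, hj,
    (hadj i' j').ne, hadj i j, (hadj i' j).symm, hadj i' j', (hadj i j').symm⟩

lemma joinedPairs_nonconst_nonempty_of_hasC4 [Nontrivial ι] [Nontrivial κ] (h : HasC4 G) :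
    {x ∈ G.joinedPairs ι κ |
      ¬ ((∃ w, x.1 = fun _ => w) ∨ ∃ w, x.2 = fun _ => w)}.Nonempty := by
  obtain ⟨a, b, c, d, -, hac, -, -, hbd, -, hab, hbc, hcd, hda⟩ := h
  obtain ⟨f, hf, hf'⟩ := exists_forall_eq_or_eq_of_nontrivial (ι := ι) hac
  obtain ⟨g, hg, hg'⟩ := exists_forall_eq_or_eq_of_nontrivial (ι := κ) hbd
  refine ⟨(f, g), mem_filter.2 ⟨G.mem_joinedPairs.2 fun i j => ?_, not_or.2 ⟨hf', hg'⟩⟩⟩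
  rcases hf i with hi | hi <;> rcases hg j with hj | hj <;> simp only [hi, hj]
  exacts [hab, hda.symm, hbc.symm, hcd]

end SimpleGraph

/-- For a finite simple bipartite graph `G` and `p, q ≥ 1`,
`hom(K_{p,q}, G) ≥ ∑_w (d_G(w)^p + d_G(w)^q) − 2|E(G)|`; equality holds if `G` is
C4-free, and conversely, if `p, q ≥ 2` and equality holds then `G` is C4-free. -/
theorem hom_count_completeBipartite_ge_degree_sum {V : Type*} [Fintype V] [DecidableEq V]
    (G : SimpleGraph V) [DecidableRel G.Adj] (hbip : G.Colorable 2)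
    (p q : ℕ) (hp : 1 ≤ p) (hq : 1 ≤ q) :
    ((Nat.card (completeBipartiteGraph (Fin p) (Fin q) →g G) : ℤ) ≥
      (∑ w : V, ((G.degree w : ℤ) ^ p + (G.degree w : ℤ) ^ q)) - 2 * G.edgeFinset.card) ∧
    (C4Free G →
      (Nat.card (completeBipartiteGraph (Fin p) (Fin q) →g G) : ℤ) =
        (∑ w : V, ((G.degree w : ℤ) ^ p + (G.degree w : ℤ) ^ q)) - 2 * G.edgeFinset.card) ∧
    (2 ≤ p → 2 ≤ q →
      (Nat.card (completeBipartiteGraph (Fin p) (Fin q) →g G) : ℤ) =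
        (∑ w : V, ((G.degree w : ℤ) ^ p + (G.degree w : ℤ) ^ q)) - 2 * G.edgeFinset.card →
      C4Free G) := by
  have : Nonempty (Fin p) := ⟨⟨0, hp⟩⟩
  have : Nonempty (Fin q) := ⟨⟨0, hq⟩⟩
  have key := G.card_joinedPairs_add (ι := Fin p) (κ := Fin q)
  simp only [Fintype.card_fin] at key
  have key' := congrArg (Nat.cast : ℕ → ℤ) key
  push_cast at key'
  rw [G.natCard_completeBipartiteHom]
  refine ⟨by omega, fun hfree => ?_, fun hp2 hq2 heq hC4 => ?_⟩
  · have h0 := not_nonempty_iff_eq_empty.1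
      fun h => hfree (G.hasC4_of_joinedPairs_nonconst_nonempty (ι := Fin p) (κ := Fin q) h)
    rw [h0, card_empty] at key'
    omega
  · have := Fin.nontrivial_iff_two_le.2 hp2
    have := Fin.nontrivial_iff_two_le.2 hq2
    have h0 := card_pos.2
      (G.joinedPairs_nonconst_nonempty_of_hasC4 (ι := Fin p) (κ := Fin q) hC4)
    omega
end

section
/- Let G be a finite simple bipartite graph that is C4-free, with a bipartition into partite sets of sizes n1 and n2, with n = n1 + n2 vertices and m edges. Then m ≤ ⌊ (1/4)·n·(1 + √(4n − 3 − 2·n1·n2/n)) ⌋. -/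
open Finset

/-- A graph `G` on the vertex set `α ⊕ β` is bipartite with respect to the fixed
bipartition `(α, β)`: every edge joins the left side to the right side. -/
def IsBipartitionedGraph {α β : Type*} (G : SimpleGraph (α ⊕ β)) : Prop :=
  ∀ u v, G.Adj u v →
    ((∃ x, u = Sum.inl x) ∧ (∃ y, v = Sum.inr y)) ∨
    ((∃ x, u = Sum.inr x) ∧ (∃ y, v = Sum.inl y))

/-- In a C4-free graph, distinct vertices have no two common neighbours. -/
theorem C4Free.disjoint_offDiag_neighborFinset {V : Type*} [Fintype V] [DecidableEq V]
    {G : SimpleGraph V} [DecidableRel G.Adj] (hC4 : C4Free G) {v w : V} (hvw : v ≠ w) :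
    Disjoint (G.neighborFinset v).offDiag (G.neighborFinset w).offDiag := by
  rw [Finset.disjoint_left]
  rintro ⟨a, b⟩ hv hw
  simp only [mem_offDiag, SimpleGraph.mem_neighborFinset] at hv hw
  obtain ⟨hva, hvb, hab⟩ := hv
  obtain ⟨hwa, hwb, -⟩ := hw
  exact hC4 ⟨v, a, w, b, hva.ne, hvw, hvb.ne, hwa.ne', hab, hwb.ne, hva, hwa.symm, hwb, hvb.symm⟩

/-- Counting paths of length two by their endpoints, which lie on the same side. -/
theorem sum_degree_sq_le_of_c4Free_bipartite {α β : Type*} [Fintype α] [Fintype β]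
    [DecidableEq α] [DecidableEq β] {G : SimpleGraph (α ⊕ β)} [DecidableRel G.Adj]
    (hbip : IsBipartitionedGraph G) (hC4 : C4Free G) :
    ∑ v, G.degree v ^ 2 + Fintype.card α + Fintype.card β ≤
      Fintype.card α ^ 2 + Fintype.card β ^ 2 + 2 * G.edgeFinset.card := by
  set A : Finset (α ⊕ β) := univ.map Function.Embedding.inl
  set B : Finset (α ⊕ β) := univ.map Function.Embedding.inr
  have hsub : univ.biUnion (fun v => (G.neighborFinset v).offDiag) ⊆ A.offDiag ∪ B.offDiag := by
    rintro ⟨a, b⟩ h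
    simp only [mem_biUnion, mem_univ, true_and, mem_offDiag, SimpleGraph.mem_neighborFinset] at h
    obtain ⟨v, hva, hvb, hab⟩ := h
    rcases hbip _ _ hva with ⟨⟨x, rfl⟩, y, rfl⟩ | ⟨⟨x, rfl⟩, y, rfl⟩ <;>
    rcases hbip _ _ hvb with ⟨⟨x', hx⟩, z, rfl⟩ | ⟨⟨x', hx⟩, z, rfl⟩ <;>
    simp_all [A, B]
  have hcard := (card_le_card hsub).trans (card_union_le _ _)
  rw [card_biUnion fun v _ w _ hvw => hC4.disjoint_offDiag_neighborFinset hvw] at hcard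
  simp only [offDiag_card, SimpleGraph.card_neighborFinset_eq_degree] at hcard
  have hA : A.card = Fintype.card α := by simp [A]
  have hB : B.card = Fintype.card β := by simp [B]
  rw [hA, hB] at hcard
  have hsum : ∑ v, G.degree v ^ 2 =
      ∑ v, (G.degree v * G.degree v - G.degree v) + ∑ v, G.degree v := by
    rw [← sum_add_distrib]
    refine sum_congr rfl fun v _ => ?_
    rw [Nat.sub_add_cancel (Nat.le_mul_self _), sq]
  rw [SimpleGraph.sum_degrees_eq_twice_card_edges] at hsum
  have h1 := Nat.le_mul_self (Fintype.card α)
  have h2 := Nat.le_mul_self (Fintype.card β)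
  simp only [sq] at hsum ⊢
  omega

/-- For a C4-free bipartite graph with partite sets of sizes `n1`, `n2`, `n = n1 + n2`
vertices and `m` edges, `m ≤ ⌊ n(1 + √(4n − 3 − 2 n1 n2 / n))/4 ⌋`. -/
theorem edge_bound_of_c4Free_bipartite {α β : Type*} [Fintype α] [Fintype β]
    [DecidableEq α] [DecidableEq β]
    (G : SimpleGraph (α ⊕ β)) [DecidableRel G.Adj]
    (hbip : IsBipartitionedGraph G) (hC4 : C4Free G)
    (n1 n2 n m : ℕ) (hn1 : n1 = Fintype.card α) (hn2 : n2 = Fintype.card β)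
    (hn : n = n1 + n2) (hm : m = G.edgeFinset.card) :
    (m : ℤ) ≤ ⌊(1 / 4 : ℝ) * (n : ℝ) *
      (1 + Real.sqrt (4 * (n : ℝ) - 3 - 2 * (n1 : ℝ) * (n2 : ℝ) / (n : ℝ)))⌋ := by
  have hsq := sum_degree_sq_le_of_c4Free_bipartite hbip hC4
  have hcs := sq_sum_le_card_mul_sum_sq (s := (univ : Finset (α ⊕ β))) (f := fun v => G.degree v)
  rw [SimpleGraph.sum_degrees_eq_twice_card_edges, card_univ, Fintype.card_sum] at hcs
  rw [← hn1, ← hn2, ← hm] at hsq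
  rw [← hn1, ← hn2, ← hn, ← hm] at hcs
  rw [Int.le_floor, Int.cast_natCast]
  rcases Nat.eq_zero_or_pos n with h0 | hpos
  · rw [h0, Nat.cast_zero, zero_mul, Nat.le_zero, sq_eq_zero_iff] at hcs
    have hm0 : m = 0 := by omega
    simp [h0, hm0]
  have hposR : (0 : ℝ) < n := by exact_mod_cast hpos
  have hbound : (2 * m : ℝ) ^ 2 ≤ n * (n1 ^ 2 + n2 ^ 2 + 2 * m - n) := by
    have hsqR : ((∑ v, G.degree v ^ 2 : ℕ) : ℝ) + n1 + n2 ≤ n1 ^ 2 + n2 ^ 2 + 2 * m := by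
      exact_mod_cast hsq
    have hcsR : (2 * m : ℝ) ^ 2 ≤ n * ((∑ v, G.degree v ^ 2 : ℕ) : ℝ) := by exact_mod_cast hcs
    refine hcsR.trans (mul_le_mul_of_nonneg_left ?_ hposR.le)
    rw [hn, Nat.cast_add]
    linarith
  have hnR : (n : ℝ) = n1 + n2 := by exact_mod_cast hn
  have hkey : (4 * m / n - 1 : ℝ) ≤ √(4 * n - 3 - 2 * n1 * n2 / n) := by
    apply Real.le_sqrt_of_sq_le
    have hprod : (0 : ℝ) ≤ n1 * n2 * n := by positivity
    have hsides : (n1 ^ 2 + n2 ^ 2 : ℝ) = n ^ 2 - 2 * n1 * n2 := by rw [hnR]; ring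
    rw [hsides] at hbound
    have hdiff : (4 * n - 3 - 2 * n1 * n2 / n : ℝ) - (4 * m / n - 1) ^ 2 =
        (4 * (n * (n ^ 2 - 2 * n1 * n2 + 2 * m - n) - (2 * m) ^ 2) + 6 * (n1 * n2 * n)) / n ^ 2 := by
      field_simp
      ring
    rw [← sub_nonneg, hdiff]
    apply div_nonneg _ (sq_nonneg _)
    linarith
  calc (m : ℝ) = 1 / 4 * n * (1 + (4 * m / n - 1)) := by field_simp; ring
    _ ≤ _ := by gcongr
end

section
/- Let T be a tree on n vertices and let p, q ≥ 1 be integers. Then hom(K_{p,q}, T) = Σ_{w ∈ V(T)} (d_T(w)^p + d_T(w)^q) − 2(n − 1). -/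
open Finset

/-- In an acyclic graph, two distinct vertices have at most one common neighbour. -/
theorem SimpleGraph.IsAcyclic.common_neighbor_unique {V : Type*} {G : SimpleGraph V}
    (hG : G.IsAcyclic) {a b c d : V} (hab : a ≠ b) (hac : G.Adj a c) (hbc : G.Adj b c)
    (had : G.Adj a d) (hbd : G.Adj b d) : c = d := by
  have hpath {x : V} (hax : G.Adj a x) (hbx : G.Adj b x) :
      (SimpleGraph.Walk.cons hax (.cons hbx.symm .nil)).IsPath := by
    simp [SimpleGraph.Walk.cons_isPath_iff, hab, hax.ne, hbx.ne']
  have := hG.subsingleton_path a b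
  have h := congrArg (fun w : G.Path a b => w.1.support)
    (Subsingleton.elim ⟨_, hpath hac hbc⟩ ⟨_, hpath had hbd⟩)
  simpa using h

/-- Homomorphisms from a complete bipartite graph are pairs of maps on the two parts whose values
are pairwise adjacent. -/
def completeBipartiteGraphHomEquiv {V : Type*} (G : SimpleGraph V) (α β : Type*) :
    (completeBipartiteGraph α β →g G) ≃
      {x : (α → V) × (β → V) // ∀ i j, G.Adj (x.1 i) (x.2 j)} where
  toFun φ := ⟨(fun i => φ (.inl i), fun j => φ (.inr j)), fun _ _ => φ.map_rel (by simp)⟩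
  invFun x := ⟨Sum.elim x.1.1 x.1.2, by
    rintro (a | a) (b | b) h
    · simp at h
    · exact x.2 a b
    · exact (x.2 b a).symm
    · simp at h⟩
  left_inv φ := by ext (_ | _) <;> rfl
  right_inv _ := rfl

section Count

variable {V : Type*} [Fintype V] [DecidableEq V] (G : SimpleGraph V) [DecidableRel G.Adj]
  (α β : Type*) [Fintype α] [Fintype β] [DecidableEq β]

/-- Pairs of a constant map on `α` and a map on `β` into the neighbourhood of its value. -/
def constLeftPairs : Finset ((α → V) × (β → V)) :=
  (univ.sigma fun w => Fintype.piFinset fun _ : β => G.neighborFinset w).image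
    fun x : (_ : V) × (β → V) => (Function.const α x.1, x.2)

variable {G α β} in
theorem mem_constLeftPairs {x : (α → V) × (β → V)} :
    x ∈ constLeftPairs G α β ↔ ∃ w, x.1 = Function.const α w ∧ ∀ j, G.Adj w (x.2 j) := by
  obtain ⟨f, g⟩ := x
  simp only [constLeftPairs, mem_image, mem_sigma, mem_univ, true_and, Fintype.mem_piFinset,
    SimpleGraph.mem_neighborFinset, Prod.mk.injEq, Sigma.exists]
  constructor
  · rintro ⟨w, _, h, rfl, rfl⟩
    exact ⟨w, rfl, h⟩
  · rintro ⟨w, rfl, h⟩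
    exact ⟨w, g, h, rfl, rfl⟩

theorem card_constLeftPairs [Nonempty α] :
    #(constLeftPairs G α β) = ∑ w, G.degree w ^ Fintype.card β := by
  rw [constLeftPairs, card_image_of_injective]
  · simp
  · rintro ⟨w, g⟩ ⟨w', g'⟩ h
    obtain ⟨h₁, rfl⟩ := Prod.mk.inj h
    obtain rfl := Function.const_injective h₁
    rfl

theorem card_constLeftPairs_inter [DecidableEq α] [Nonempty α] [Nonempty β] :
    #(constLeftPairs G α β ∩ (constLeftPairs G β α).map (Equiv.prodComm _ _).toEmbedding) =
      ∑ w, G.degree w := by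
  have h : constLeftPairs G α β ∩ (constLeftPairs G β α).map (Equiv.prodComm _ _).toEmbedding =
      (univ.sigma fun w => G.neighborFinset w).image
        fun x : (_ : V) × V => (Function.const α x.1, Function.const β x.2) := by
    ext ⟨f, g⟩
    simp only [mem_inter, mem_map_equiv, mem_constLeftPairs, mem_image, mem_sigma, mem_univ,
      true_and, SimpleGraph.mem_neighborFinset, Sigma.exists, Prod.mk.injEq,
      Equiv.prodComm_symm, Equiv.prodComm_apply, Prod.swap]
    constructor
    · rintro ⟨⟨w, rfl, h⟩, v, rfl, -⟩
      exact ⟨w, v, h (Classical.arbitrary β), rfl, rfl⟩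
    · rintro ⟨w, v, h, rfl, rfl⟩
      exact ⟨⟨w, rfl, fun _ => h⟩, v, rfl, fun _ => h.symm⟩
  rw [h, card_image_of_injective]
  · simp
  · rintro ⟨w, v⟩ ⟨w', v'⟩ h
    obtain ⟨h₁, h₂⟩ := Prod.mk.inj h
    obtain rfl := Function.const_injective h₁
    obtain rfl := Function.const_injective h₂
    rfl

variable {G α β} in
/-- In an acyclic graph, a homomorphism from a complete bipartite graph is constant on one of the
two parts. -/
theorem SimpleGraph.IsAcyclic.mem_union_constLeftPairs_iff (hG : G.IsAcyclic)
    [DecidableEq α] [Nonempty α] [Nonempty β] (x : (α → V) × (β → V)) :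
    x ∈ constLeftPairs G α β ∪ (constLeftPairs G β α).map (Equiv.prodComm _ _).toEmbedding ↔
      ∀ i j, G.Adj (x.1 i) (x.2 j) := by
  obtain ⟨f, g⟩ := x
  simp only [mem_union, mem_map_equiv, mem_constLeftPairs,
    Equiv.prodComm_symm, Equiv.prodComm_apply, Prod.swap]
  constructor
  · rintro (⟨w, rfl, h⟩ | ⟨w, rfl, h⟩)
    · exact fun _ j => h j
    · exact fun i _ => (h i).symm
  · intro h
    let i₀ := Classical.arbitrary α
    let j₀ := Classical.arbitrary β
    by_cases hf : ∀ i, f i = f i₀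
    · exact .inl ⟨f i₀, funext hf, h i₀⟩
    · obtain ⟨i, hi⟩ := not_forall.mp hf
      exact .inr ⟨g j₀, funext fun j => hG.common_neighbor_unique hi (h i j) (h i₀ j) (h i j₀)
        (h i₀ j₀), fun k => (h k j₀).symm⟩

end Count

/-- For a tree `T` on `n` vertices and `p, q ≥ 1`,
`hom(K_{p,q}, T) = ∑_w (d_T(w)^p + d_T(w)^q) − 2(n − 1)`. -/
theorem hom_count_completeBipartite_to_tree {V : Type*} [Fintype V] [DecidableEq V]
    (T : SimpleGraph V) [DecidableRel T.Adj] (hT : T.IsTree)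
    (n : ℕ) (hn : n = Fintype.card V)
    (p q : ℕ) (hp : 1 ≤ p) (hq : 1 ≤ q) :
    (Nat.card (completeBipartiteGraph (Fin p) (Fin q) →g T) : ℤ) =
      (∑ w : V, ((T.degree w : ℤ) ^ p + (T.degree w : ℤ) ^ q)) - 2 * ((n : ℤ) - 1) := by
  have : Nonempty (Fin p) := ⟨⟨0, hp⟩⟩
  have : Nonempty (Fin q) := ⟨⟨0, hq⟩⟩
  have hcard := card_union_add_card_inter (constLeftPairs T (Fin p) (Fin q))
    ((constLeftPairs T (Fin q) (Fin p)).map (Equiv.prodComm _ _).toEmbedding)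
  rw [card_constLeftPairs_inter, card_map,
    card_constLeftPairs, card_constLeftPairs, T.sum_degrees_eq_twice_card_edges,
    Fintype.card_fin, Fintype.card_fin] at hcard
  have hedges := hT.card_edgeFinset
  rw [Nat.card_congr (completeBipartiteGraphHomEquiv T _ _),
    Nat.subtype_card _ hT.isAcyclic.mem_union_constLeftPairs_iff, sum_add_distrib]
  zify at hcard hedges
  subst hn
  linarith
end

section
/- Let G be a finite simple bipartite graph with n vertices and m edges, and let p, q ≥ 1 be integers. Then hom(K_{p,q}, G) ≥ 2^p·n^{1−p}·m^p + 2^q·n^{1−q}·m^q − 2m. Moreover, if G is C4-free and regular then equality holds; and conversely, if p ≥ 2 and q ≥ 2 and equality holds, then G is C4-free and regular. -/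
open Finset

section Bicliques

variable {V : Type*} [Fintype V] [DecidableEq V] (G : SimpleGraph V) [DecidableRel G.Adj]
  (ι κ : Type*) [Fintype ι] [Fintype κ] [DecidableEq ι] [DecidableEq κ]

/-- The pairs of maps `f : ι → V`, `g : κ → V` such that every `f i` is adjacent to every `g j`. -/
def bicliqueMaps : Finset ((ι → V) × (κ → V)) :=
  univ.filter fun x => ∀ i j, G.Adj (x.1 i) (x.2 j)

/-- The pairs in `bicliqueMaps` whose first map is constant. -/
def leftStarMaps : Finset ((ι → V) × (κ → V)) :=
  (bicliqueMaps G ι κ).filter fun x => ∀ i i', x.1 i = x.1 i'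

/-- The pairs in `bicliqueMaps` whose second map is constant. -/
def rightStarMaps : Finset ((ι → V) × (κ → V)) :=
  (bicliqueMaps G ι κ).filter fun x => ∀ j j', x.2 j = x.2 j'

/-- Homomorphisms from a complete bipartite graph are pairs of completely adjacent maps. -/
def homEquivBicliqueMaps : (completeBipartiteGraph ι κ →g G) ≃ bicliqueMaps G ι κ where
  toFun φ := ⟨(fun i => φ (Sum.inl i), fun j => φ (Sum.inr j)), by
    simp only [bicliqueMaps, mem_filter, mem_univ, true_and]
    exact fun i j => φ.map_rel (by simp)⟩
  invFun x := ⟨Sum.elim x.1.1 x.1.2, by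
    have hx := (mem_filter.1 x.2).2
    rintro (i | j) (i' | j') h
    · simp at h
    · exact hx i j'
    · exact (hx i' j).symm
    · simp at h⟩
  left_inv φ := by
    ext (i | j) <;> rfl
  right_inv x := rfl

omit [DecidableEq V] in
theorem card_hom_eq_card_bicliqueMaps :
    Nat.card (completeBipartiteGraph ι κ →g G) = #(bicliqueMaps G ι κ) := by
  rw [Nat.card_congr (homEquivBicliqueMaps G ι κ), Nat.card_eq_fintype_card, Fintype.card_coe]

theorem card_leftStarMaps [Nonempty ι] :
    #(leftStarMaps G ι κ) = ∑ v, G.degree v ^ Fintype.card κ := by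
  have h : #(univ.sigma fun v => Fintype.piFinset fun _ : κ => G.neighborFinset v) =
      ∑ v, G.degree v ^ Fintype.card κ := by
    simp [card_sigma]
  rw [← h]
  refine card_nbij' (fun x => ⟨x.1 (Classical.arbitrary ι), x.2⟩)
    (fun y => (fun _ => y.1, y.2)) ?_ ?_ ?_ ?_
  · rintro ⟨f, g⟩ hx
    simp only [leftStarMaps, bicliqueMaps, mem_coe, mem_filter, mem_univ, true_and] at hx
    simpa using hx.1 _
  · rintro ⟨v, g⟩ hy
    simpa [leftStarMaps, bicliqueMaps] using hy
  · rintro ⟨f, g⟩ hx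
    simp only [leftStarMaps, mem_coe, mem_filter] at hx
    exact Prod.ext (funext fun i => hx.2 _ _) rfl
  · rintro ⟨v, g⟩ _
    rfl

theorem card_rightStarMaps [Nonempty κ] :
    #(rightStarMaps G ι κ) = ∑ v, G.degree v ^ Fintype.card ι := by
  rw [← card_leftStarMaps G κ ι]
  refine card_nbij' Prod.swap Prod.swap ?_ ?_ (fun _ _ => rfl) (fun _ _ => rfl)
  · rintro ⟨f, g⟩ hx
    simp only [rightStarMaps, leftStarMaps, bicliqueMaps, mem_coe, mem_filter, mem_univ,
      true_and, Prod.swap] at hx ⊢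
    exact ⟨fun i j => (hx.1 j i).symm, hx.2⟩
  · rintro ⟨f, g⟩ hx
    simp only [rightStarMaps, leftStarMaps, bicliqueMaps, mem_coe, mem_filter, mem_univ,
      true_and, Prod.swap] at hx ⊢
    exact ⟨fun i j => (hx.1 j i).symm, hx.2⟩

theorem card_leftStarMaps_inter_rightStarMaps [Nonempty ι] [Nonempty κ] :
    #(leftStarMaps G ι κ ∩ rightStarMaps G ι κ) = 2 * #G.edgeFinset := by
  have h : #(univ.sigma fun v => G.neighborFinset v) = 2 * #G.edgeFinset := by
    simp [card_sigma, ← G.sum_degrees_eq_twice_card_edges]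
  rw [← h]
  refine card_nbij' (fun x => ⟨x.1 (Classical.arbitrary ι), x.2 (Classical.arbitrary κ)⟩)
    (fun y => (fun _ => y.1, fun _ => y.2)) ?_ ?_ ?_ ?_
  · rintro ⟨f, g⟩ hx
    simp only [leftStarMaps, bicliqueMaps, coe_inter, Set.mem_inter_iff, mem_coe, mem_filter,
      mem_univ, true_and] at hx
    simpa using hx.1.1 _ _
  · rintro ⟨v, w⟩ hy
    simpa [leftStarMaps, rightStarMaps, bicliqueMaps] using hy
  · rintro ⟨f, g⟩ hx
    simp only [leftStarMaps, rightStarMaps, coe_inter, Set.mem_inter_iff, mem_coe,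
      mem_filter] at hx
    exact Prod.ext (funext fun i => hx.1.2 _ _) (funext fun j => hx.2.2 _ _)
  · rintro ⟨v, w⟩ _
    rfl

theorem card_starMaps_add [Nonempty ι] [Nonempty κ] :
    #(leftStarMaps G ι κ ∪ rightStarMaps G ι κ) + 2 * #G.edgeFinset =
      ∑ v, G.degree v ^ Fintype.card ι + ∑ v, G.degree v ^ Fintype.card κ := by
  rw [← card_leftStarMaps_inter_rightStarMaps G ι κ, card_union_add_card_inter,
    card_leftStarMaps, card_rightStarMaps, add_comm]

theorem starMaps_subset_bicliqueMaps :
    leftStarMaps G ι κ ∪ rightStarMaps G ι κ ⊆ bicliqueMaps G ι κ :=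
  union_subset (filter_subset _ _) (filter_subset _ _)

variable {G}

theorem C4Free.bicliqueMaps_eq (h : C4Free G) :
    bicliqueMaps G ι κ = leftStarMaps G ι κ ∪ rightStarMaps G ι κ := by
  refine (starMaps_subset_bicliqueMaps G ι κ).antisymm' fun x hx => ?_
  by_contra hcon
  simp only [leftStarMaps, rightStarMaps, mem_union, mem_filter, hx, true_and, not_or,
    not_forall] at hcon
  obtain ⟨⟨i, i', hi⟩, j, j', hj⟩ := hcon
  have hadj := (mem_filter.1 hx).2
  exact h ⟨x.1 i, x.2 j, x.1 i', x.2 j', (hadj i j).ne, hi, (hadj i j').ne,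
    (hadj i' j).ne.symm, hj, (hadj i' j').ne, hadj i j, (hadj i' j).symm, hadj i' j',
    (hadj i j').symm⟩

theorem C4Free.of_bicliqueMaps_eq [Nontrivial ι] [Nontrivial κ]
    (h : bicliqueMaps G ι κ = leftStarMaps G ι κ ∪ rightStarMaps G ι κ) : C4Free G := by
  rintro ⟨a, b, c, d, -, hac, -, -, hbd, -, hab, hbc, hcd, hda⟩
  obtain ⟨i, i', hi⟩ := exists_pair_ne ι
  obtain ⟨j, j', hj⟩ := exists_pair_ne κ
  let x : (ι → V) × (κ → V) := (fun k => if k = i then a else c, fun k => if k = j then b else d)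
  have hx : x ∈ bicliqueMaps G ι κ := by
    refine mem_filter.2 ⟨mem_univ _, fun k l => ?_⟩
    dsimp only [x]
    split_ifs
    exacts [hab, hda.symm, hbc.symm, hcd]
  rw [h, mem_union] at hx
  rcases hx with hx | hx
  · exact hac (by simpa [x, hi.symm] using (mem_filter.1 hx).2 i i')
  · exact hbd (by simpa [x, hj.symm] using (mem_filter.1 hx).2 j j')

end Bicliques

section PowerMean

variable {α : Type*} [Fintype α]

theorem card_rpow_mul_sum_pow (f : α → ℝ) {p : ℕ} (hp : 1 ≤ p) :
    (Fintype.card α : ℝ) ^ ((1 : ℝ) - (p : ℝ)) * (∑ a, f a) ^ p =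
      (∑ a, f a) ^ p / (Fintype.card α : ℝ) ^ (p - 1) := by
  have : (1 : ℝ) - (p : ℝ) = -((p - 1 : ℕ) : ℝ) := by
    push_cast [hp]; ring
  rw [this, Real.rpow_neg (Nat.cast_nonneg _), Real.rpow_natCast, inv_mul_eq_div]

theorem card_rpow_mul_sum_pow_le_sum_pow (f : α → ℝ) (hf : ∀ a, 0 ≤ f a) {p : ℕ} (hp : 1 ≤ p) :
    (Fintype.card α : ℝ) ^ ((1 : ℝ) - (p : ℝ)) * (∑ a, f a) ^ p ≤ ∑ a, f a ^ p := by
  rw [card_rpow_mul_sum_pow f hp]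
  obtain ⟨k, rfl⟩ := Nat.exists_eq_add_of_le' hp
  exact pow_sum_div_card_le_sum_pow (fun a _ => hf a) k

theorem card_rpow_mul_sum_pow_const (c : ℝ) {p : ℕ} (hp : 1 ≤ p) :
    (Fintype.card α : ℝ) ^ ((1 : ℝ) - (p : ℝ)) * (∑ _a : α, c) ^ p = ∑ _a : α, c ^ p := by
  rw [card_rpow_mul_sum_pow _ hp]
  obtain ⟨k, rfl⟩ := Nat.exists_eq_add_of_le' hp
  simp only [sum_const, card_univ, nsmul_eq_mul, Nat.add_sub_cancel]
  rcases eq_or_ne (Fintype.card α : ℝ) 0 with h | h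
  · simp [h]
  · rw [div_eq_iff (pow_ne_zero _ h)]
    ring

theorem eq_of_card_rpow_mul_sum_pow_eq (f : α → ℝ) (hf : ∀ a, 0 ≤ f a) {p : ℕ} (hp : 2 ≤ p)
    (h : (Fintype.card α : ℝ) ^ ((1 : ℝ) - (p : ℝ)) * (∑ a, f a) ^ p = ∑ a, f a ^ p) (a b : α) :
    f a = f b := by
  have hn : (0 : ℝ) < Fintype.card α := Nat.cast_pos.2 (Fintype.card_pos_iff.2 ⟨a⟩)
  rw [card_rpow_mul_sum_pow f (by lia)] at h
  refine (strictConvexOn_pow hp).eq_of_le_map_sum (t := univ)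
    (w := fun _ => (Fintype.card α : ℝ)⁻¹) (p := f) (fun _ _ => inv_pos.2 hn) ?_
    (fun i _ => hf i) ?_ (mem_univ a) (mem_univ b)
  · simp [hn.ne']
  · simp only [smul_eq_mul, ← mul_sum, ← h]
    obtain ⟨k, rfl⟩ := Nat.exists_eq_add_of_le' (show 1 ≤ p by lia)
    apply le_of_eq
    rw [Nat.add_sub_cancel, mul_pow]
    rw [inv_pow]
    field_simp
    ring

end PowerMean

/-- For a finite simple bipartite graph `G` with `n` vertices and `m` edges and `p, q ≥ 1`,
`hom(K_{p,q}, G) ≥ 2^p n^{1−p} m^p + 2^q n^{1−q} m^q − 2m` (with real powers);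
equality holds if `G` is C4-free and regular, and conversely, if `p, q ≥ 2` and equality
holds then `G` is C4-free and regular. -/
theorem hom_count_completeBipartite_ge_regular_bound {V : Type*} [Fintype V] [DecidableEq V]
    (G : SimpleGraph V) [DecidableRel G.Adj] (hbip : G.Colorable 2)
    (n m : ℕ) (hn : n = Fintype.card V) (hm : m = G.edgeFinset.card)
    (p q : ℕ) (hp : 1 ≤ p) (hq : 1 ≤ q) :
    ((Nat.card (completeBipartiteGraph (Fin p) (Fin q) →g G) : ℝ) ≥
      2 ^ p * (n : ℝ) ^ ((1 : ℝ) - (p : ℝ)) * (m : ℝ) ^ p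
        + 2 ^ q * (n : ℝ) ^ ((1 : ℝ) - (q : ℝ)) * (m : ℝ) ^ q - 2 * (m : ℝ)) ∧
    (C4Free G ∧ (∃ d, G.IsRegularOfDegree d) →
      (Nat.card (completeBipartiteGraph (Fin p) (Fin q) →g G) : ℝ) =
        2 ^ p * (n : ℝ) ^ ((1 : ℝ) - (p : ℝ)) * (m : ℝ) ^ p
          + 2 ^ q * (n : ℝ) ^ ((1 : ℝ) - (q : ℝ)) * (m : ℝ) ^ q - 2 * (m : ℝ)) ∧
    (2 ≤ p → 2 ≤ q →
      (Nat.card (completeBipartiteGraph (Fin p) (Fin q) →g G) : ℝ) =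
        2 ^ p * (n : ℝ) ^ ((1 : ℝ) - (p : ℝ)) * (m : ℝ) ^ p
          + 2 ^ q * (n : ℝ) ^ ((1 : ℝ) - (q : ℝ)) * (m : ℝ) ^ q - 2 * (m : ℝ) →
      C4Free G ∧ ∃ d, G.IsRegularOfDegree d) := by
  have hp0 : Nonempty (Fin p) := ⟨⟨0, hp⟩⟩
  have hq0 : Nonempty (Fin q) := ⟨⟨0, hq⟩⟩
  have hsum : ∑ v, (G.degree v : ℝ) = 2 * m := by
    rw [hm]
    exact_mod_cast G.sum_degrees_eq_twice_card_edges
  have hterm (r : ℕ) : 2 ^ r * (n : ℝ) ^ ((1 : ℝ) - (r : ℝ)) * (m : ℝ) ^ r =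
      (Fintype.card V : ℝ) ^ ((1 : ℝ) - (r : ℝ)) * (∑ v, (G.degree v : ℝ)) ^ r := by
    rw [hsum, hn, mul_pow]
    ring
  have hstar : (#(leftStarMaps G (Fin p) (Fin q) ∪ rightStarMaps G (Fin p) (Fin q)) : ℝ) =
      ∑ v, (G.degree v : ℝ) ^ p + ∑ v, (G.degree v : ℝ) ^ q - 2 * m := by
    have h := card_starMaps_add G (Fin p) (Fin q)
    simp only [Fintype.card_fin, ← hm] at h
    rw [eq_sub_iff_add_eq]
    exact_mod_cast h
  have hsub := starMaps_subset_bicliqueMaps G (Fin p) (Fin q)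
  have hle : (#(leftStarMaps G (Fin p) (Fin q) ∪ rightStarMaps G (Fin p) (Fin q)) : ℝ) ≤
      #(bicliqueMaps G (Fin p) (Fin q)) := Nat.cast_le.2 (card_le_card hsub)
  have hdeg (v : V) : (0 : ℝ) ≤ G.degree v := Nat.cast_nonneg _
  have hP := card_rpow_mul_sum_pow_le_sum_pow _ hdeg hp
  have hQ := card_rpow_mul_sum_pow_le_sum_pow _ hdeg hq
  rw [card_hom_eq_card_bicliqueMaps, hterm p, hterm q]
  refine ⟨by linarith, ?_, fun hp2 hq2 heq => ⟨?_, ?_⟩⟩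
  · rintro ⟨hC4, d, hd⟩
    rw [hC4.bicliqueMaps_eq (Fin p) (Fin q), hstar]
    simp only [hd.degree_eq]
    rw [card_rpow_mul_sum_pow_const _ hp, card_rpow_mul_sum_pow_const _ hq]
  · have : Nontrivial (Fin p) := Fin.nontrivial_iff_two_le.2 hp2
    have : Nontrivial (Fin q) := Fin.nontrivial_iff_two_le.2 hq2
    refine C4Free.of_bicliqueMaps_eq (Fin p) (Fin q) (eq_of_subset_of_card_le hsub ?_).symm
    exact Nat.cast_le (α := ℝ).1 (by linarith)
  · have hconst := eq_of_card_rpow_mul_sum_pow_eq _ hdeg hp2 (by linarith)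
    rcases isEmpty_or_nonempty V with hV | ⟨⟨a⟩⟩
    · exact ⟨0, fun v => hV.elim v⟩
    · exact ⟨G.degree a, fun v => Nat.cast_injective (hconst v a)⟩
end

section
/- Let p, q, n be positive integers with n ≥ 3, and let C_n denote the cycle graph on n vertices. Then hom(K_{p,q}, C_n) = n·(2^p + 2^q − 2) if n = 3 or n ≥ 5, and hom(K_{p,q}, C_4) = 2^{p+q+1}. -/
open SimpleGraph

/-- A homomorphism out of a complete bipartite graph is a pair of maps, one on each part,
with all values on one part adjacent to all values on the other. -/
def SimpleGraph.completeBipartiteHomEquiv_s5 {V : Type*} (G : SimpleGraph V) (α β : Type*) :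
    (completeBipartiteGraph α β →g G) ≃
      {x : (α → V) × (β → V) | ∀ i j, G.Adj (x.1 i) (x.2 j)} where
  toFun φ := ⟨(fun i => φ (Sum.inl i), fun j => φ (Sum.inr j)),
    fun i j => φ.map_rel (by simp [completeBipartiteGraph])⟩
  invFun x := ⟨Sum.elim x.1.1 x.1.2, by
    rintro (i | i) (j | j) h
    · simp [completeBipartiteGraph] at h
    · exact x.2 i j
    · exact (x.2 j i).symm
    · simp [completeBipartiteGraph] at h⟩
  left_inv φ := by
    ext (i | i) <;> rfl
  right_inv x := rfl

section Counting

variable {V α β : Type*} {G : SimpleGraph V}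

/-- In a `d`-regular graph on `V` there are `|V| d ^ |β|` pairs consisting of a constant map to a
vertex and a map from `β` into its neighbourhood. -/
theorem SimpleGraph.IsRegularOfDegree.ncard_const_left [Fintype V] [DecidableRel G.Adj] [Fintype β]
    [Nonempty α] {d : ℕ} (hG : G.IsRegularOfDegree d) :
    {x : (α → V) × (β → V) | (∃ v, x.1 = fun _ => v) ∧ ∀ i j, G.Adj (x.1 i) (x.2 j)}.ncard =
      Fintype.card V * d ^ Fintype.card β := by
  classical
  have h : {x : (α → V) × (β → V) | (∃ v, x.1 = fun _ => v) ∧ ∀ i j, G.Adj (x.1 i) (x.2 j)} =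
      Set.range (fun y : Σ v : V, β → G.neighborSet v =>
        ((fun _ => y.1, fun j => (y.2 j : V)) : (α → V) × (β → V))) := by
    ext ⟨f, g⟩
    constructor
    · rintro ⟨⟨v, rfl⟩, h⟩
      exact ⟨⟨v, fun j => ⟨g j, h (Classical.arbitrary α) j⟩⟩, rfl⟩
    · rintro ⟨⟨v, y⟩, h⟩
      obtain ⟨rfl, rfl⟩ := Prod.mk.inj h
      exact ⟨⟨v, rfl⟩, fun _ j => (y j).2⟩
  have hinj : Function.Injective (fun y : Σ v : V, β → G.neighborSet v =>
      ((fun _ => y.1, fun j => (y.2 j : V)) : (α → V) × (β → V))) := by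
    rintro ⟨v, y⟩ ⟨w, z⟩ hyz
    obtain ⟨h₁, h₂⟩ := Prod.mk.inj hyz
    obtain rfl : v = w := congrFun h₁ (Classical.arbitrary α)
    obtain rfl : y = z := funext fun j => Subtype.ext (congrFun h₂ j)
    rfl
  rw [h, ← Nat.card_coe_set_eq, Nat.card_range_of_injective hinj, Nat.card_eq_fintype_card,
    Fintype.card_sigma]
  simp only [Fintype.card_fun, card_neighborSet_eq_degree, hG.degree_eq, Finset.sum_const,
    Finset.card_univ, smul_eq_mul]

/-- The same count as `ncard_const_left` with the two parts exchanged. -/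
theorem SimpleGraph.IsRegularOfDegree.ncard_const_right [Fintype V] [DecidableRel G.Adj]
    [Fintype α] [Nonempty β] {d : ℕ} (hG : G.IsRegularOfDegree d) :
    {x : (α → V) × (β → V) | (∃ v, x.2 = fun _ => v) ∧ ∀ i j, G.Adj (x.1 i) (x.2 j)}.ncard =
      Fintype.card V * d ^ Fintype.card α := by
  rw [← hG.ncard_const_left (α := β) (β := α),
    ← Set.ncard_image_of_injective _ Prod.swap_injective]
  congr 1
  ext ⟨f, g⟩
  simp only [Set.image_swap_eq_preimage_swap, Set.mem_preimage, Set.mem_ofPred_eq, Prod.fst_swap,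
    Prod.snd_swap]
  exact and_congr_right fun _ => ⟨fun h i j => (h j i).symm, fun h i j => (h j i).symm⟩

/-- In a `d`-regular graph on `V` there are `|V| d` pairs of constant maps to adjacent vertices. -/
theorem SimpleGraph.IsRegularOfDegree.ncard_const_const [Fintype V] [DecidableRel G.Adj]
    [Nonempty α] [Nonempty β] {d : ℕ} (hG : G.IsRegularOfDegree d) :
    {x : (α → V) × (β → V) | ((∃ v, x.1 = fun _ => v) ∧ ∃ v, x.2 = fun _ => v) ∧
      ∀ i j, G.Adj (x.1 i) (x.2 j)}.ncard = Fintype.card V * d := by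
  have hinj : Function.Injective (fun y : (α → V) × (Unit → V) =>
      ((y.1, fun _ => y.2 ()) : (α → V) × (β → V))) := by
    rintro ⟨f, g⟩ ⟨f', g'⟩ h
    obtain ⟨h₁, h₂⟩ := Prod.mk.inj h
    exact Prod.ext h₁ (funext fun _ => congrFun h₂ (Classical.arbitrary β))
  have h := hG.ncard_const_left (α := α) (β := Unit)
  rw [Fintype.card_unit, pow_one, ← Set.ncard_image_of_injective _ hinj] at h
  rw [← h]
  congr 1
  ext ⟨f, g⟩
  constructor
  · rintro ⟨⟨⟨v, rfl⟩, w, rfl⟩, h⟩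
    exact ⟨(fun _ => v, fun _ => w),
      ⟨⟨v, rfl⟩, fun i _ => h i (Classical.arbitrary β)⟩, rfl⟩
  · rintro ⟨⟨f', g'⟩, ⟨hf, h⟩, he⟩
    obtain ⟨rfl, rfl⟩ := Prod.mk.inj he
    exact ⟨⟨hf, _, rfl⟩, fun i _ => h i ()⟩

/-- A map from a nonempty type is constant, or takes two distinct values. -/
theorem Function.exists_eq_const_or_exists_ne [Nonempty α] (f : α → V) :
    (∃ v, f = fun _ => v) ∨ ∃ i i', f i ≠ f i' := by
  by_contra! h
  exact h.1 (f (Classical.arbitrary α)) (funext fun i => h.2 i _)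

/-- The number of homomorphisms from a complete bipartite graph to a `d`-regular graph
without 4-cycles. -/
theorem SimpleGraph.IsRegularOfDegree.card_completeBipartite_hom_add [Fintype V]
    [DecidableRel G.Adj] [Fintype α] [Fintype β] [Nonempty α] [Nonempty β] {d : ℕ}
    (hG : G.IsRegularOfDegree d)
    (hC : ∀ a b c e, G.Adj a c → G.Adj a e → G.Adj b c → G.Adj b e → a = b ∨ c = e) :
    Nat.card (completeBipartiteGraph α β →g G) + Fintype.card V * d =
      Fintype.card V * d ^ Fintype.card α + Fintype.card V * d ^ Fintype.card β := by
  rw [Nat.card_congr (G.completeBipartiteHomEquiv_s5 α β), Nat.card_coe_set_eq,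
    ← hG.ncard_const_const (α := α) (β := β), ← hG.ncard_const_right (α := α) (β := β),
    ← hG.ncard_const_left (α := α) (β := β),
    ← Set.ncard_union_add_ncard_inter {x : (α → V) × (β → V) |
      (∃ v, x.2 = fun _ => v) ∧ ∀ i j, G.Adj (x.1 i) (x.2 j)} _ (Set.toFinite _) (Set.toFinite _)]
  congr 2
  · ext ⟨f, g⟩
    simp only [Set.mem_union, Set.mem_ofPred_eq, ← or_and_right]
    refine ⟨fun h => ⟨?_, h⟩, And.right⟩
    rcases Function.exists_eq_const_or_exists_ne g with hg | ⟨j, j', hj⟩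
    · exact .inl hg
    rcases Function.exists_eq_const_or_exists_ne f with hf | ⟨i, i', hi⟩
    · exact .inr hf
    exact ((hC _ _ _ _ (h i j) (h i j') (h i' j) (h i' j')).elim hi hj).elim
  · ext ⟨f, g⟩
    simp only [Set.mem_inter_iff, Set.mem_ofPred_eq]
    tauto

end Counting

/-- Cycles of length other than 4 contain no 4-cycle. -/
theorem SimpleGraph.cycleGraph_eq_or_eq_of_adj {n : ℕ} (hn : n = 3 ∨ 5 ≤ n) (a b c e : Fin n)
    (hac : (cycleGraph n).Adj a c) (hae : (cycleGraph n).Adj a e)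
    (hbc : (cycleGraph n).Adj b c) (hbe : (cycleGraph n).Adj b e) : a = b ∨ c = e := by
  rcases hn with rfl | hn
  · revert a b c e
    decide
  · obtain ⟨m, rfl⟩ := Nat.exists_eq_add_of_le' hn
    have h4 : (1 : Fin (m + 5)) + 1 + 1 + 1 ≠ 0 := by
      intro h
      have := congrArg Fin.val h
      have h' : 4 % (m + 5) = 0 := by simpa [Fin.val_add] using this
      rw [Nat.mod_eq_of_lt (by omega)] at h'
      omega
    rw [cycleGraph_adj] at hac hae hbc hbe
    by_contra! hne
    grind

/-- The 4-cycle is complete bipartite between its even and its odd vertices. -/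
theorem SimpleGraph.exists_equiv_cycleGraph_four :
    ∃ e : Bool × Bool ≃ Fin 4, ∀ x y, (cycleGraph 4).Adj (e x) (e y) ↔ y.1 = !x.1 := by
  let f : Bool × Bool → Fin 4 := fun x => (if x.1 then 1 else 0) + (if x.2 then 2 else 0)
  have hf : Function.Bijective f := by decide
  exact ⟨Equiv.ofBijective f hf, by
    simp only [Equiv.ofBijective_apply]
    decide⟩

/-- The number of homomorphisms from a complete bipartite graph to the 4-cycle. -/
theorem SimpleGraph.card_completeBipartite_hom_cycleGraph_four {α β : Type*} [Fintype α]
    [Fintype β] [Nonempty α] [Nonempty β] :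
    Nat.card (completeBipartiteGraph α β →g cycleGraph 4) =
      2 ^ (Fintype.card α + Fintype.card β + 1) := by
  classical
  obtain ⟨e, he⟩ := exists_equiv_cycleGraph_four
  let F : Bool × (α → Bool) × (β → Bool) → (α → Fin 4) × (β → Fin 4) :=
    fun x => (fun i => e (x.1, x.2.1 i), fun j => e (!x.1, x.2.2 j))
  have hinj : Function.Injective F := by
    rintro ⟨b, x, y⟩ ⟨b', x', y'⟩ h
    obtain ⟨h₁, h₂⟩ := Prod.mk.inj h
    have h₁' := fun i => Prod.mk.inj (e.injective (congrFun h₁ i))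
    have h₂' := fun j => Prod.mk.inj (e.injective (congrFun h₂ j))
    exact Prod.ext (h₁' (Classical.arbitrary α)).1
      (Prod.ext (funext fun i => (h₁' i).2) (funext fun j => (h₂' j).2))
  have hrange : {x : (α → Fin 4) × (β → Fin 4) | ∀ i j, (cycleGraph 4).Adj (x.1 i) (x.2 j)} =
      Set.range F := by
    ext ⟨f, g⟩
    constructor
    · intro h
      have hpar : ∀ i j, (e.symm (g j)).1 = !(e.symm (f i)).1 := fun i j => by
        rw [← he, e.apply_symm_apply, e.apply_symm_apply]
        exact h i j
      let i₀ : α := Classical.arbitrary α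
      let j₀ : β := Classical.arbitrary β
      refine ⟨((e.symm (f i₀)).1, fun i => (e.symm (f i)).2, fun j => (e.symm (g j)).2), ?_⟩
      refine Prod.ext (funext fun i => ?_) (funext fun j => ?_)
      · have : (e.symm (f i₀)).1 = (e.symm (f i)).1 :=
          Bool.not_inj ((hpar i₀ j₀).symm.trans (hpar i j₀))
        simp [F, this]
      · simp [F, ← hpar i₀ j]
    · rintro ⟨x, h⟩ i j
      obtain ⟨rfl, rfl⟩ := Prod.mk.inj h
      exact (he _ _).2 rfl
  rw [Nat.card_congr ((cycleGraph 4).completeBipartiteHomEquiv_s5 α β), hrange,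
    Nat.card_range_of_injective hinj, Nat.card_eq_fintype_card]
  simp only [Fintype.card_prod, Fintype.card_fun, Fintype.card_bool]
  ring


/-- The number of homomorphisms from `K_{p,q}` to the cycle `C_n` (`n ≥ 3`):
it equals `n(2^p + 2^q − 2)` if `n = 3` or `n ≥ 5`, and `2^{p+q+1}` if `n = 4`. -/
theorem hom_count_completeBipartite_to_cycle (p q n : ℕ)
    (hp : 1 ≤ p) (hq : 1 ≤ q) (hn : 3 ≤ n) :
    ((n = 3 ∨ 5 ≤ n) →
      Nat.card (completeBipartiteGraph (Fin p) (Fin q) →g SimpleGraph.cycleGraph n) =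
        n * (2 ^ p + 2 ^ q - 2)) ∧
    Nat.card (completeBipartiteGraph (Fin p) (Fin q) →g SimpleGraph.cycleGraph 4) =
      2 ^ (p + q + 1) := by
  have : Nonempty (Fin p) := ⟨⟨0, hp⟩⟩
  have : Nonempty (Fin q) := ⟨⟨0, hq⟩⟩
  constructor
  · intro h
    have hreg : (cycleGraph n).IsRegularOfDegree 2 := by
      obtain ⟨m, rfl⟩ := Nat.exists_eq_add_of_le' hn
      exact fun v => cycleGraph_degree_three_le
    have hcard := hreg.card_completeBipartite_hom_add (α := Fin p) (β := Fin q)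
      (cycleGraph_eq_or_eq_of_adj h)
    simp only [Fintype.card_fin] at hcard
    rw [Nat.mul_sub, Nat.mul_add]
    omega
  · simpa using card_completeBipartite_hom_cycleGraph_four (α := Fin p) (β := Fin q)
end

section
/- Let G be a finite simple bipartite graph with a bipartition into partite sets of sizes n1 and n2, and let δ = |E(G)|/(n1·n2) be its edge density. Then for all positive integers p, q, hom(K_{p,q}, G) ≥ δ^{pq}·(n1^p·n2^q + n1^q·n2^p). -/
open Finset

/-- Power mean inequality: the `p`-th power of the mean is at most the mean of the `p`-th powers. -/
theorem card_mul_mean_pow_le_sum_pow {ι : Type*} [Fintype ι] (f : ι → ℝ) (hf : ∀ i, 0 ≤ f i)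
    {p : ℕ} (hp : 1 ≤ p) :
    (Fintype.card ι : ℝ) * ((∑ i, f i) / Fintype.card ι) ^ p ≤ ∑ i, f i ^ p := by
  obtain ⟨k, rfl⟩ := Nat.exists_eq_add_of_le' hp
  rcases isEmpty_or_nonempty ι with h | h
  · simp
  · have hc : (0 : ℝ) < Fintype.card ι := by exact_mod_cast Fintype.card_pos
    have key := pow_sum_div_card_le_sum_pow (s := univ) (f := f) (fun i _ => hf i) k
    rw [card_univ] at key
    refine le_of_eq_of_le ?_ key
    rw [div_pow]
    field_simp
    ring

/-- Pairs of tuples that are completely joined by the relation `R`. -/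
abbrev CompletelyJoined {α β : Type*} (R : α → β → Prop) (p q : ℕ) : Type _ :=
  {x : (Fin p → α) × (Fin q → β) // ∀ i j, R (x.1 i) (x.2 j)}

theorem card_completelyJoined {α β : Type*} [Fintype α] [Finite β]
    (R : α → β → Prop) (p q : ℕ) :
    Nat.card (CompletelyJoined R p q) =
      ∑ f : Fin p → α, Nat.card {y // ∀ i, R (f i) y} ^ q := by
  let e : CompletelyJoined R p q ≃ Σ f : Fin p → α, Fin q → {y // ∀ i, R (f i) y} :=
    { toFun := fun x => ⟨x.1.1, fun j => ⟨x.1.2 j, fun i => x.2 i j⟩⟩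
      invFun := fun s => ⟨(s.1, fun j => (s.2 j).1), fun i j => (s.2 j).2 i⟩
      left_inv := fun _ => rfl
      right_inv := fun _ => rfl }
  rw [Nat.card_congr e, Nat.card_sigma]
  simp [Nat.card_fun]

theorem sum_card_common_neighbors {α β : Type*} [Fintype α] [Fintype β]
    (R : α → β → Prop) (p : ℕ) :
    ∑ f : Fin p → α, Nat.card {y // ∀ i, R (f i) y} = ∑ y, Nat.card {x // R x y} ^ p := by
  let e : (Σ f : Fin p → α, {y // ∀ i, R (f i) y}) ≃ Σ y : β, Fin p → {x // R x y} :=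
    { toFun := fun s => ⟨s.2.1, fun i => ⟨s.1 i, s.2.2 i⟩⟩
      invFun := fun s => ⟨fun i => (s.2 i).1, ⟨s.1, fun i => (s.2 i).2⟩⟩
      left_inv := fun _ => rfl
      right_inv := fun _ => rfl }
  have h := Nat.card_congr e
  rw [Nat.card_sigma, Nat.card_sigma] at h
  simpa [Nat.card_fun] using h

theorem density_pow_mul_le_card_completelyJoined {α β : Type*} [Fintype α] [Fintype β]
    (R : α → β → Prop) {p q : ℕ} (hp : 1 ≤ p) (hq : 1 ≤ q) :
    ((∑ y, Nat.card {x // R x y} : ℕ) / ((Fintype.card α : ℝ) * Fintype.card β)) ^ (p * q) *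
      ((Fintype.card α : ℝ) ^ p * (Fintype.card β : ℝ) ^ q) ≤
      Nat.card (CompletelyJoined R p q) := by
  rcases isEmpty_or_nonempty α with hα | hα
  · simp [Nat.one_le_iff_ne_zero.1 hp]
  rcases isEmpty_or_nonempty β with hβ | hβ
  · simp [Nat.one_le_iff_ne_zero.1 hq]
  have ha : (0 : ℝ) < Fintype.card α := by exact_mod_cast Fintype.card_pos
  have hb : (0 : ℝ) < Fintype.card β := by exact_mod_cast Fintype.card_pos
  have hdeg := card_mul_mean_pow_le_sum_pow (fun y : β => (Nat.card {x // R x y} : ℝ))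
    (fun _ => Nat.cast_nonneg _) hp
  have hcommon := card_mul_mean_pow_le_sum_pow
    (fun f : Fin p → α => (Nat.card {y // ∀ i, R (f i) y} : ℝ)) (fun _ => Nat.cast_nonneg _) hq
  have hsum := congrArg (Nat.cast : ℕ → ℝ) (sum_card_common_neighbors R p)
  push_cast at hsum
  rw [hsum] at hcommon
  rw [card_completelyJoined]
  push_cast
  refine le_trans ?_ hcommon
  rw [Fintype.card_fun, Fintype.card_fin]
  push_cast
  refine le_trans (le_of_eq ?_) (mul_le_mul_of_nonneg_left
    (pow_le_pow_left₀ (by positivity) (div_le_div_of_nonneg_right hdeg (by positivity)) q)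
    (by positivity))
  rw [pow_mul, div_pow, div_pow (∑ y, (Nat.card {x // R x y} : ℝ)), mul_pow]
  field_simp
  rw [← mul_pow]
  ring

theorem edgeFinset_card_le_sum_card_neighbors {α β : Type*} [Fintype α] [Fintype β]
    [DecidableEq α] [DecidableEq β]
    (G : SimpleGraph (α ⊕ β)) [DecidableRel G.Adj] (hbip : IsBipartitionedGraph G) :
    #G.edgeFinset ≤ ∑ y, Nat.card {x // G.Adj (Sum.inl x) (Sum.inr y)} := by
  rw [← Nat.card_sigma, Nat.card_eq_fintype_card, ← card_univ]
  refine card_le_card_of_surjOn (fun s => s(Sum.inl s.2.1, Sum.inr s.1)) ?_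
  intro e he
  induction e with
  | _ u v =>
    have huv : G.Adj u v := by simpa using he
    rcases hbip u v huv with ⟨⟨x, rfl⟩, ⟨y, rfl⟩⟩ | ⟨⟨y, rfl⟩, ⟨x, rfl⟩⟩
    · exact ⟨⟨y, x, huv⟩, by simp, rfl⟩
    · exact ⟨⟨y, x, huv.symm⟩, by simp, Sym2.eq_swap⟩

theorem card_completelyJoined_add_le_card_hom {α β : Type*} [Finite α] [Finite β]
    (G : SimpleGraph (α ⊕ β)) {p : ℕ} (q : ℕ) (hp : 1 ≤ p) :
    Nat.card (CompletelyJoined (fun x y => G.Adj (Sum.inl x) (Sum.inr y)) p q) +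
      Nat.card (CompletelyJoined (fun y x => G.Adj (Sum.inl x) (Sum.inr y)) p q) ≤
      Nat.card (completeBipartiteGraph (Fin p) (Fin q) →g G) := by
  have : Finite (completeBipartiteGraph (Fin p) (Fin q) →g G) := DFunLike.finite _
  rw [← Nat.card_sum]
  refine Nat.card_le_card_of_injective
    (Sum.elim
      (fun s => ⟨Sum.elim (fun i => Sum.inl (s.1.1 i)) (fun j => Sum.inr (s.1.2 j)), ?_⟩)
      (fun s => ⟨Sum.elim (fun i => Sum.inr (s.1.1 i)) (fun j => Sum.inl (s.1.2 j)), ?_⟩)) ?_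
  · rintro (i | i) (j | j) h
    · simp at h
    · exact s.2 i j
    · exact (s.2 j i).symm
    · simp at h
  · rintro (i | i) (j | j) h
    · simp at h
    · exact (s.2 i j).symm
    · exact s.2 j i
    · simp at h
  · rintro (⟨⟨f, g⟩, hs⟩ | ⟨⟨f, g⟩, hs⟩) (⟨⟨f', g'⟩, ht⟩ | ⟨⟨f', g'⟩, ht⟩) h
    all_goals
      have h' := fun v => DFunLike.congr_fun h v
      have hl := fun i => h' (Sum.inl i)
      have hr := fun j => h' (Sum.inr j)
    · obtain rfl : f = f' := funext fun i => Sum.inl_injective (hl i)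
      obtain rfl : g = g' := funext fun j => Sum.inr_injective (hr j)
      rfl
    · exact absurd (hl ⟨0, hp⟩) Sum.inl_ne_inr
    · exact absurd (hl ⟨0, hp⟩) Sum.inr_ne_inl
    · obtain rfl : f = f' := funext fun i => Sum.inr_injective (hl i)
      obtain rfl : g = g' := funext fun j => Sum.inl_injective (hr j)
      rfl

/-- For a bipartite graph `G` with partite sets of sizes `n1, n2` and edge density
`δ = |E(G)|/(n1 n2)`, and all positive integers `p, q`,
`hom(K_{p,q}, G) ≥ δ^{pq} (n1^p n2^q + n1^q n2^p)`. -/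
theorem hom_count_completeBipartite_ge_density_bound {α β : Type*} [Fintype α] [Fintype β]
    [DecidableEq α] [DecidableEq β]
    (G : SimpleGraph (α ⊕ β)) [DecidableRel G.Adj] (hbip : IsBipartitionedGraph G)
    (n1 n2 : ℕ) (hn1 : n1 = Fintype.card α) (hn2 : n2 = Fintype.card β)
    (δ : ℝ) (hδ : δ = (G.edgeFinset.card : ℝ) / ((n1 : ℝ) * (n2 : ℝ)))
    (p q : ℕ) (hp : 1 ≤ p) (hq : 1 ≤ q) :
    (Nat.card (completeBipartiteGraph (Fin p) (Fin q) →g G) : ℝ) ≥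
      δ ^ (p * q) * ((n1 : ℝ) ^ p * (n2 : ℝ) ^ q + (n1 : ℝ) ^ q * (n2 : ℝ) ^ p) := by
  subst hn1 hn2
  set R : α → β → Prop := fun x y => G.Adj (Sum.inl x) (Sum.inr y)
  have hswap : ∑ x, Nat.card {y // R x y} = ∑ y, Nat.card {x // R x y} := by
    have h := sum_card_common_neighbors R 1
    simp only [pow_one, Fin.forall_fin_one] at h
    rw [← h]
    exact ((Equiv.funUnique (Fin 1) α).sum_comp fun x => Nat.card {y // R x y}).symm
  have hle : δ ≤ (∑ y, Nat.card {x // R x y} : ℕ) /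
      ((Fintype.card α : ℝ) * Fintype.card β) := by
    rw [hδ]
    gcongr
    exact edgeFinset_card_le_sum_card_neighbors G hbip
  have hδ0 : 0 ≤ δ := by rw [hδ]; positivity
  have hpow := pow_le_pow_left₀ hδ0 hle (p * q)
  have hleft := density_pow_mul_le_card_completelyJoined R hp hq
  have hright := density_pow_mul_le_card_completelyJoined (fun y x => R x y) hp hq
  rw [hswap, mul_comm (Fintype.card β : ℝ)] at hright
  have hhom : (Nat.card (CompletelyJoined R p q) : ℝ) +
      Nat.card (CompletelyJoined (fun y x => R x y) p q) ≤
      Nat.card (completeBipartiteGraph (Fin p) (Fin q) →g G) := by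
    exact_mod_cast card_completelyJoined_add_le_card_hom G q hp
  refine ge_iff_le.2 (le_trans ?_ hhom)
  refine le_trans (mul_le_mul_of_nonneg_right hpow (by positivity)) ?_
  rw [mul_add, mul_comm ((Fintype.card α : ℝ) ^ q)]
  exact add_le_add hleft hright
end

section
/- For all positive integers p, q, n1, n2 and every real δ ∈ (0, 1], the inequality δ^{pq}·(n1^p·n2^q + n1^q·n2^p) ≥ (2δ)^{pq}·(n1+n2)^{p+q−2pq}·(n1·n2)^{pq} holds; that is, the entropy-based lower bound on hom(K_{p,q}, G) is at least as large as the lower bound implied by Sidorenko's inequality for a bipartite target graph with partite sets of sizes n1 and n2 and edge density δ. -/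
/-- A product of two AM-GM estimates, with the surplus power of two made explicit by `k` and `m`. -/
theorem two_pow_mul_mul_pow_le {a b : ℝ} (ha : 0 ≤ a) (hb : 0 ≤ b) {p q k m : ℕ}
    (hk : k + p + q = 2 * m) (hm : m ≤ k + 1) :
    2 ^ m * (a * b) ^ m ≤ (a ^ p * b ^ q + a ^ q * b ^ p) * (a + b) ^ k := by
  obtain ⟨x, hx, rfl⟩ : ∃ x : ℝ, 0 ≤ x ∧ x ^ 2 = a := ⟨√a, a.sqrt_nonneg, Real.sq_sqrt ha⟩
  obtain ⟨y, hy, rfl⟩ : ∃ y : ℝ, 0 ≤ y ∧ y ^ 2 = b := ⟨√b, b.sqrt_nonneg, Real.sq_sqrt hb⟩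
  have h₁ : 2 * (x * y) ^ (p + q) ≤
      (x ^ 2) ^ p * (y ^ 2) ^ q + (x ^ 2) ^ q * (y ^ 2) ^ p := by
    have h := two_mul_le_add_sq (x ^ p * y ^ q) (x ^ q * y ^ p)
    calc _ = 2 * (x ^ p * y ^ q) * (x ^ q * y ^ p) := by ring
      _ ≤ _ := h
      _ = _ := by ring
  have h₂ : 2 * (x * y) ≤ x ^ 2 + y ^ 2 := by
    linarith [two_mul_le_add_sq x y]
  calc 2 ^ m * (x ^ 2 * y ^ 2) ^ m
      ≤ 2 ^ (k + 1) * (x ^ 2 * y ^ 2) ^ m := by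
        gcongr
        norm_num
    _ = 2 ^ (k + 1) * (x * y) ^ (k + p + q) := by rw [hk, pow_mul, mul_pow x y 2]
    _ = (2 * (x * y) ^ (p + q)) * (2 * (x * y)) ^ k := by ring
    _ ≤ _ := by gcongr

/-- For positive integers `p, q, n1, n2` and `δ ∈ (0,1]`, the entropy-based lower
bound dominates the Sidorenko lower bound:
`δ^{pq} (n1^p n2^q + n1^q n2^p) ≥ (2δ)^{pq} (n1+n2)^{p+q−2pq} (n1 n2)^{pq}`. -/
theorem entropy_bound_ge_sidorenko_bound (p q n1 n2 : ℕ)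
    (hp : 1 ≤ p) (hq : 1 ≤ q) (hn1 : 1 ≤ n1) (hn2 : 1 ≤ n2)
    (δ : ℝ) (hδ0 : 0 < δ) (hδ1 : δ ≤ 1) :
    δ ^ (p * q) * ((n1 : ℝ) ^ p * (n2 : ℝ) ^ q + (n1 : ℝ) ^ q * (n2 : ℝ) ^ p) ≥
      (2 * δ) ^ (p * q) *
        ((n1 : ℝ) + (n2 : ℝ)) ^ ((p : ℝ) + (q : ℝ) - 2 * ((p : ℝ) * (q : ℝ))) *
        ((n1 : ℝ) * (n2 : ℝ)) ^ (p * q) := by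
  obtain ⟨k, hk, hm⟩ : ∃ k : ℕ, k + p + q = 2 * (p * q) ∧ p * q ≤ k + 1 := by
    obtain ⟨r, rfl⟩ := Nat.exists_eq_add_of_le hp
    obtain ⟨s, rfl⟩ := Nat.exists_eq_add_of_le hq
    exact ⟨2 * (r * s) + r + s, by ring, by nlinarith [Nat.zero_le (r * s)]⟩
  have hkR : (k : ℝ) + p + q = 2 * (p * q) := by exact_mod_cast hk
  have hs : (0 : ℝ) < (n1 : ℝ) + n2 := by positivity
  have hexp : (p : ℝ) + q - 2 * (p * q) = -(k : ℝ) := by linarith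
  rw [hexp, Real.rpow_neg hs.le, Real.rpow_natCast, ge_iff_le]
  have key := two_pow_mul_mul_pow_le (Nat.cast_nonneg (α := ℝ) n1) (Nat.cast_nonneg n2) hk hm
  calc _ = δ ^ (p * q) * (2 ^ (p * q) * ((n1 : ℝ) * n2) ^ (p * q) / ((n1 : ℝ) + n2) ^ k) := by
        rw [mul_pow 2 δ]
        ring
    _ ≤ _ := by
        gcongr
        rwa [div_le_iff₀ (by positivity)]
end

section
/- Let p, q, n1, n2 be positive integers and let r = max(n1,n2)/min(n1,n2). Then the ratio of the entropy-based lower bound to the Sidorenko lower bound satisfies (n1^p·n2^q + n1^q·n2^p) / (2^{pq}·(n1+n2)^{p+q−2pq}·(n1·n2)^{pq}) ≥ 2^{pq−(p+q)}·(1 + r^{−|p−q|}). -/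
/-- A weighted form of `4ab ≤ (a + b)²`, where the larger base carries the larger exponent. -/
theorem two_pow_mul_mul_pow_le_of_le {a b : ℝ} (hb : 0 < b) (hab : b ≤ a) {p q m n : ℕ}
    (hqp : q ≤ p) (hm : m + (p + q) = 2 * n) :
    2 ^ m * (a * b) ^ n ≤ a ^ p * b ^ q * (a + b) ^ m := by
  have ha : 0 < a := hb.trans_le hab
  obtain ⟨k, rfl⟩ := Nat.exists_eq_add_of_le hqp
  refine le_of_sq_le_sq ?_ (by positivity)
  calc (2 ^ m * (a * b) ^ n) ^ 2
      = (4 * (a * b)) ^ m * ((a * b) ^ (2 * q) * (a ^ k * b ^ k)) := by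
        have h : ((a * b) ^ n) ^ 2 = (a * b) ^ m * ((a * b) ^ (2 * q) * (a * b) ^ k) := by
          rw [← pow_mul, ← pow_add, ← pow_add]
          congr 1
          omega
        rw [mul_pow, h, ← mul_pow a b k, mul_pow 4, ← pow_mul, mul_comm m 2, pow_mul]
        norm_num
        ring
    _ ≤ ((a + b) ^ 2) ^ m * ((a * b) ^ (2 * q) * (a ^ k * a ^ k)) := by
        gcongr
        nlinarith [sq_nonneg (a - b)]
    _ = (a ^ (q + k) * b ^ q * (a + b) ^ m) ^ 2 := by
        rw [← pow_mul, mul_comm 2 m, pow_mul]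
        ring

/-- The ratio bound for ordered real bases and ordered exponents. -/
theorem ratio_bound_of_le {a b : ℝ} (hb : 0 < b) (hab : b ≤ a) {p q : ℕ}
    (hq : 1 ≤ q) (hqp : q ≤ p) :
    (2 : ℝ) ^ ((p : ℝ) * (q : ℝ) - ((p : ℝ) + (q : ℝ))) *
        (1 + (a / b) ^ (-|(p : ℝ) - (q : ℝ)|)) ≤
      (a ^ p * b ^ q + a ^ q * b ^ p) /
        ((2 : ℝ) ^ (p * q) * (a + b) ^ ((p : ℝ) + (q : ℝ) - 2 * ((p : ℝ) * (q : ℝ))) *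
          (a * b) ^ (p * q)) := by
  have ha : 0 < a := hb.trans_le hab
  obtain ⟨m, hm⟩ : ∃ m, m + (p + q) = 2 * (p * q) :=
    ⟨2 * (p * q) - (p + q), Nat.sub_add_cancel (by nlinarith)⟩
  have key := two_pow_mul_mul_pow_le_of_le hb hab hqp hm
  have hmR : (m : ℝ) + (p + q) = 2 * (p * q) := by exact_mod_cast hm
  have hsum : (a + b) ^ ((p : ℝ) + q - 2 * (p * q)) = ((a + b) ^ m)⁻¹ := by
    rw [← Real.rpow_natCast, ← Real.rpow_neg (by positivity)]
    congr 1
    linarith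
  have htwo : (2 : ℝ) ^ ((p : ℝ) * q - (p + q)) = 2 ^ m / 2 ^ (p * q) := by
    rw [← Real.rpow_natCast, ← Real.rpow_natCast, ← Real.rpow_sub (by norm_num)]
    congr 1
    push_cast
    linarith
  obtain ⟨k, rfl⟩ := Nat.exists_eq_add_of_le hqp
  have hr : (a / b) ^ (-|((q + k : ℕ) : ℝ) - q|) = b ^ k / a ^ k := by
    have habs : |((q + k : ℕ) : ℝ) - q| = k := by simp
    rw [habs, Real.rpow_neg (by positivity), Real.rpow_natCast, div_pow, inv_div]
  have hnum : a ^ (q + k) * b ^ q + a ^ q * b ^ (q + k) =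
      a ^ (q + k) * b ^ q * (1 + b ^ k / a ^ k) := by
    field_simp
    ring
  have hfactor : a ^ (q + k) * b ^ q * (1 + b ^ k / a ^ k) /
        (2 ^ ((q + k) * q) * ((a + b) ^ m)⁻¹ * (a * b) ^ ((q + k) * q)) =
      a ^ (q + k) * b ^ q * (a + b) ^ m / (a * b) ^ ((q + k) * q) / 2 ^ ((q + k) * q) *
        (1 + b ^ k / a ^ k) := by
    field_simp
  rw [hsum, htwo, hr, hnum, hfactor]
  gcongr
  rwa [le_div_iff₀ (by positivity)]

/-- For positive integers `p, q, n1, n2` and `r = max(n1,n2)/min(n1,n2)`, the ratio of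
the entropy-based lower bound to the Sidorenko lower bound satisfies
`(n1^p n2^q + n1^q n2^p) / (2^{pq} (n1+n2)^{p+q−2pq} (n1 n2)^{pq})
  ≥ 2^{pq−(p+q)} (1 + r^{−|p−q|})`. -/
theorem entropy_to_sidorenko_ratio_bound (p q n1 n2 : ℕ)
    (hp : 1 ≤ p) (hq : 1 ≤ q) (hn1 : 1 ≤ n1) (hn2 : 1 ≤ n2)
    (r : ℝ) (hr : r = ((max n1 n2 : ℕ) : ℝ) / ((min n1 n2 : ℕ) : ℝ)) :
    ((n1 : ℝ) ^ p * (n2 : ℝ) ^ q + (n1 : ℝ) ^ q * (n2 : ℝ) ^ p) /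
        ((2 : ℝ) ^ (p * q) *
          ((n1 : ℝ) + (n2 : ℝ)) ^ ((p : ℝ) + (q : ℝ) - 2 * ((p : ℝ) * (q : ℝ))) *
          ((n1 : ℝ) * (n2 : ℝ)) ^ (p * q)) ≥
      (2 : ℝ) ^ ((p : ℝ) * (q : ℝ) - ((p : ℝ) + (q : ℝ))) *
        (1 + r ^ (-|(p : ℝ) - (q : ℝ)|)) := by
  subst hr
  wlog hn : n2 ≤ n1 generalizing n1 n2
  · convert this n2 n1 hn2 hn1 (by omega) using 1
    · congr 1
      · ring
      · rw [add_comm (n1 : ℝ), mul_comm (n1 : ℝ)]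
    · rw [max_comm, min_comm]
  wlog hpq : q ≤ p generalizing p q
  · convert this q p hq hp (by omega) using 1
    · congr 1
      · ring
      · rw [add_comm (p : ℝ), mul_comm (p : ℝ), mul_comm p]
    · rw [add_comm (p : ℝ), mul_comm (p : ℝ), abs_sub_comm]
  rw [max_eq_left hn, min_eq_right hn]
  exact ratio_bound_of_le (by exact_mod_cast hn2) (by exact_mod_cast hn) hq hpq
end

section
/- Let G be a finite simple bipartite graph with a bipartition into partite sets U and V of sizes n1 and n2 respectively, with at least one edge, and let m = |E(G)|. Define x = Σ_{u ∈ U} (d_G(u)/m)·ln(m/d_G(u)) and y = Σ_{v ∈ V} (d_G(v)/m)·ln(m/d_G(v)), where terms with d_G(u) = 0 (respectively d_G(v) = 0) are taken to be 0. Then for all positive integers p, q, hom(K_{p,q}, G) ≥ max{ m^{pq}·exp(−p(q−1)x − q(p−1)y), m^{q}·exp(−(q−1)x), m^{p}·exp(−(p−1)y) } + max{ m^{pq}·exp(−q(p−1)x − p(q−1)y), m^{p}·exp(−(p−1)x), m^{q}·exp(−(q−1)y) }. -/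
open Finset

/-- Jensen's inequality for the exponential, with the values written as logarithms. -/
lemma exp_sum_mul_log_le {ι : Type*} (s : Finset ι) (P f : ι → ℝ) (hP : ∀ i ∈ s, 0 ≤ P i)
    (hP1 : ∑ i ∈ s, P i = 1) (hf : ∀ i ∈ s, 0 < f i) :
    Real.exp (∑ i ∈ s, P i * Real.log (f i)) ≤ ∑ i ∈ s, P i * f i := by
  have h := convexOn_exp.map_sum_le (t := s) (w := P) (p := fun i => Real.log (f i)) hP hP1
    (fun _ _ => Set.mem_univ _)
  simp only [smul_eq_mul] at h
  refine h.trans_eq (sum_congr rfl fun i hi => ?_)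
  rw [Real.exp_log (hf i hi)]

section Relation

variable {α β : Type*} [Fintype α] [Fintype β] (R : α → β → Prop)

open Classical in
/-- The stars with `k` labelled (not necessarily distinct) leaves in `β` and centre in `α`. -/
noncomputable def labelledStars (k : ℕ) : Finset (Σ _ : α, Fin k → β) :=
  univ.sigma fun u => Fintype.piFinset fun _ => univ.bipartiteAbove R u

/-- The type of labelled copies of `K_{p,q}` in a relation, with the `p` side in `α`. -/
abbrev BicliqueHom (p q : ℕ) : Type _ :=
  {f : (Fin p → α) × (Fin q → β) // ∀ i j, R (f.1 i) (f.2 j)}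

open Classical in
/-- The common neighbours in `α` of a tuple of elements of `β`. -/
noncomputable def commonNeighbors {k : ℕ} (w : Fin k → β) : Finset α :=
  univ.filter fun u => ∀ j, R u (w j)

variable {R}

omit [Fintype β] in
lemma mem_commonNeighbors {k : ℕ} {w : Fin k → β} {u : α} :
    u ∈ commonNeighbors R w ↔ ∀ j, R u (w j) := by
  simp [commonNeighbors]

lemma mem_labelledStars {k : ℕ} {s : Σ _ : α, Fin k → β} :
    s ∈ labelledStars R k ↔ ∀ j, R s.1 (s.2 j) := by
  simp [labelledStars, bipartiteAbove]

lemma sum_labelledStars_eq_sum_commonNeighbors {k : ℕ} (F : α → (Fin k → β) → ℝ) :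
    ∑ s ∈ labelledStars R k, F s.1 s.2 = ∑ w, ∑ u ∈ commonNeighbors R w, F u w := by
  classical
  rw [labelledStars, sum_sigma]
  refine sum_comm' fun u w => ?_
  simp [mem_commonNeighbors, bipartiteAbove]

variable (R)

lemma card_bicliqueHom (p q : ℕ) :
    Nat.card (BicliqueHom R p q) = ∑ w : Fin q → β, #(commonNeighbors R w) ^ p := by
  classical
  let e : BicliqueHom R p q ≃ Σ w : Fin q → β, Fin p → commonNeighbors R w :=
    { toFun := fun f => ⟨f.1.2, fun i => ⟨f.1.1 i, mem_commonNeighbors.2 fun j => f.2 i j⟩⟩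
      invFun := fun g => ⟨(fun i => g.2 i, g.1), fun i j => mem_commonNeighbors.1 (g.2 i).2 j⟩
      left_inv := fun _ => rfl
      right_inv := fun _ => rfl }
  rw [Nat.card_congr e, Nat.card_eq_fintype_card, Fintype.card_sigma]
  simp

lemma card_bicliqueHom_eq_sum_labelledStars (p q : ℕ) :
    (Nat.card (BicliqueHom R (p + 1) q) : ℝ) =
      ∑ s ∈ labelledStars R q, (#(commonNeighbors R s.2) : ℝ) ^ p := by
  rw [card_bicliqueHom, sum_labelledStars_eq_sum_commonNeighbors
    (fun _ w => (#(commonNeighbors R w) : ℝ) ^ p)]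
  push_cast
  refine sum_congr rfl fun w _ => ?_
  rw [sum_const, nsmul_eq_mul, pow_succ']

omit [Fintype α] [Fintype β] in
lemma card_bicliqueHom_swap (p q : ℕ) :
    Nat.card (BicliqueHom R p q) = Nat.card (BicliqueHom (fun v u => R u v) q p) :=
  Nat.card_congr
    { toFun := fun f => ⟨f.1.swap, fun i j => f.2 j i⟩
      invFun := fun f => ⟨f.1.swap, fun i j => f.2 j i⟩
      left_inv := fun _ => rfl
      right_inv := fun _ => rfl }

variable [∀ u v, Decidable (R u v)]

/-- The entropy of the `α`-endpoint of a uniformly random edge. -/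
noncomputable def degreeEntropy (m : ℝ) : ℝ :=
  ∑ u : α, ((#(univ.bipartiteAbove R u) : ℝ) / m) *
    Real.log (m / (#(univ.bipartiteAbove R u) : ℝ))

/-- The probability of a star obtained by choosing a random edge and then resampling leaves
independently. -/
noncomputable def starWeight (m : ℝ) (k : ℕ) (u : α) : ℝ :=
  (m * (#(univ.bipartiteAbove R u) : ℝ) ^ k)⁻¹

lemma sum_starWeight_center (m : ℝ) (k : ℕ) (f : α → ℝ) :
    ∑ s ∈ labelledStars R (k + 1), starWeight R m k s.1 * f s.1 =
      ∑ u, (#(univ.bipartiteAbove R u) : ℝ) / m * f u := by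
  classical
  rw [labelledStars, sum_sigma]
  refine sum_congr rfl fun u _ => ?_
  change ∑ w ∈ _, starWeight R m k u * f u = _
  rw [sum_const, nsmul_eq_mul, Fintype.card_piFinset_const, starWeight]
  have : #(@bipartiteAbove α β R univ u fun _ => Classical.propDecidable _) =
    #(univ.bipartiteAbove R u) := by congr!
  rw [this]
  rcases eq_or_ne (#(univ.bipartiteAbove R u)) 0 with h | h
  · simp [h]
  · have : (#(univ.bipartiteAbove R u) : ℝ) ≠ 0 := by exact_mod_cast h
    push_cast
    rw [mul_inv, pow_succ]
    field_simp

lemma sum_starWeight_leaf (m : ℝ) (k : ℕ) (j : Fin (k + 1)) (g : β → ℝ) :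
    ∑ s ∈ labelledStars R (k + 1), starWeight R m k s.1 * g (s.2 j) =
      ∑ v, (#(univ.bipartiteBelow R v) : ℝ) / m * g v := by
  classical
  have h1 : ∀ v, (#(univ.bipartiteBelow R v) : ℝ) / m * g v =
      ∑ u ∈ univ.bipartiteBelow R v, m⁻¹ * g v := fun v => by
    rw [sum_const, nsmul_eq_mul]; ring
  simp_rw [h1]
  rw [← sum_sum_bipartiteAbove_eq_sum_sum_bipartiteBelow R (fun _ v => m⁻¹ * g v),
    labelledStars, sum_sigma]
  refine sum_congr rfl fun u _ => ?_
  have : (@bipartiteAbove α β R univ u fun _ => Classical.propDecidable _) =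
    univ.bipartiteAbove R u := by congr!
  rw [this]
  simp only
  rw [← mul_sum, Fintype.sum_piFinset_apply g, ← mul_sum, nsmul_eq_mul, starWeight]
  rcases (univ.bipartiteAbove R u).eq_empty_or_nonempty with h | h
  · simp [h]
  · have : (#(univ.bipartiteAbove R u) : ℝ) ≠ 0 := by exact_mod_cast h.card_pos.ne'
    simp only [Fintype.card_fin, Nat.add_sub_cancel]
    push_cast
    rw [mul_inv, ← mul_assoc]
    field_simp

variable {R}

lemma card_bipartiteAbove_pos {k : ℕ} {s : Σ _ : α, Fin (k + 1) → β}
    (hs : s ∈ labelledStars R (k + 1)) : 0 < (#(univ.bipartiteAbove R s.1) : ℝ) :=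
  Nat.cast_pos.2 <| card_pos.2 ⟨s.2 0, by simpa [bipartiteAbove] using mem_labelledStars.1 hs 0⟩

lemma card_bipartiteBelow_pos {k : ℕ} {s : Σ _ : α, Fin k → β}
    (hs : s ∈ labelledStars R k) (j : Fin k) : 0 < (#(univ.bipartiteBelow R (s.2 j)) : ℝ) :=
  Nat.cast_pos.2 <| card_pos.2 ⟨s.1, by simpa [bipartiteBelow] using mem_labelledStars.1 hs j⟩

omit [∀ u v, Decidable (R u v)] in
lemma card_commonNeighbors_pos {k : ℕ} {s : Σ _ : α, Fin k → β}
    (hs : s ∈ labelledStars R k) : 0 < (#(commonNeighbors R s.2) : ℝ) :=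
  Nat.cast_pos.2 <| card_pos.2 ⟨s.1, mem_commonNeighbors.2 (mem_labelledStars.1 hs)⟩

lemma starWeight_pos {m : ℝ} (hm0 : 0 < m) {k : ℕ} {s : Σ _ : α, Fin (k + 1) → β}
    (hs : s ∈ labelledStars R (k + 1)) : 0 < starWeight R m k s.1 :=
  inv_pos.2 (mul_pos hm0 (pow_pos (card_bipartiteAbove_pos hs) k))

lemma sum_starWeight {m : ℝ} (hm0 : 0 < m)
    (hm : ∑ u, (#(univ.bipartiteAbove R u) : ℝ) = m) (k : ℕ) :
    ∑ s ∈ labelledStars R (k + 1), starWeight R m k s.1 = 1 := by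
  have := sum_starWeight_center R m k (fun _ => 1)
  simp only [mul_one] at this
  rw [this, ← sum_div, hm, div_self hm0.ne']

/-- The entropy of a random star. -/
lemma sum_starWeight_mul_log {m : ℝ} (hm0 : 0 < m)
    (hm : ∑ u, (#(univ.bipartiteAbove R u) : ℝ) = m) (k : ℕ) :
    ∑ s ∈ labelledStars R (k + 1), starWeight R m k s.1 * Real.log (starWeight R m k s.1)⁻¹ =
      (k + 1) * Real.log m - k * degreeEntropy R m := by
  have h1 : ∀ s ∈ labelledStars R (k + 1),
      starWeight R m k s.1 * Real.log (starWeight R m k s.1)⁻¹ =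
      starWeight R m k s.1 * ((k + 1) * Real.log m -
        k * Real.log (m / #(univ.bipartiteAbove R s.1))) := fun s hs => by
    have hd := card_bipartiteAbove_pos hs
    congr 1
    rw [starWeight, inv_inv, Real.log_mul hm0.ne' (pow_pos hd k).ne', Real.log_pow,
      Real.log_div hm0.ne' hd.ne']
    ring
  rw [sum_congr rfl h1]
  simp_rw [mul_sub]
  rw [sum_sub_distrib, ← sum_mul, sum_starWeight hm0 hm, one_mul, degreeEntropy, mul_sum,
    sum_starWeight_center R m k (fun u => k * Real.log (m / #(univ.bipartiteAbove R u)))]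
  congr 1
  exact sum_congr rfl fun u _ => by ring

lemma sum_starWeight_mul_sum_log_leaf (m : ℝ) (k : ℕ) :
    ∑ s ∈ labelledStars R (k + 1), starWeight R m k s.1 *
        ∑ j, Real.log (m / #(univ.bipartiteBelow R (s.2 j))) =
      (k + 1) * degreeEntropy (fun v u => R u v) m := by
  simp_rw [mul_sum]
  rw [sum_comm]
  simp_rw [sum_starWeight_leaf R m k _ (fun v => Real.log (m / #(univ.bipartiteBelow R v)))]
  rw [sum_const, card_univ, Fintype.card_fin, nsmul_eq_mul]
  push_cast
  rfl

/-- Subadditivity of entropy, bounding the conditional entropy of the centre of a random star given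
its leaves. -/
lemma le_sum_starWeight_mul_log_commonNeighbors {m : ℝ} (hm0 : 0 < m)
    (hm : ∑ u, (#(univ.bipartiteAbove R u) : ℝ) = m)
    (hm' : ∑ v, (#(univ.bipartiteBelow R v) : ℝ) = m) (k : ℕ) :
    (k + 1) * Real.log m - k * degreeEntropy R m - (k + 1) * degreeEntropy (fun v u => R u v) m ≤
      ∑ s ∈ labelledStars R (k + 1), starWeight R m k s.1 *
        Real.log (#(commonNeighbors R s.2)) := by
  classical
  set Q : (Fin (k + 1) → β) → ℝ := fun w => ∏ j, (#(univ.bipartiteBelow R (w j)) : ℝ) / m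
  have hQ0 : ∀ w, 0 ≤ Q w := fun w => prod_nonneg fun j _ => by positivity
  have hQ1 : ∑ w, Q w = 1 := by
    have := sum_pow' (univ : Finset β) (fun v => (#(univ.bipartiteBelow R v) : ℝ) / m) (k + 1)
    rw [← sum_div, hm', div_self hm0.ne', one_pow, Fintype.piFinset_univ] at this
    exact this.symm
  have hQpos : ∀ s ∈ labelledStars R (k + 1), 0 < Q s.2 := fun s hs =>
    prod_pos fun j _ => div_pos (card_bipartiteBelow_pos hs j) hm0
  have hJ := exp_sum_mul_log_le (labelledStars R (k + 1)) (fun s => starWeight R m k s.1)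
    (fun s => Q s.2 * ((starWeight R m k s.1)⁻¹ * (#(commonNeighbors R s.2) : ℝ)⁻¹))
    (fun s hs => (starWeight_pos hm0 hs).le) (sum_starWeight hm0 hm k)
    (fun s hs => mul_pos (hQpos s hs) (mul_pos (inv_pos.2 (starWeight_pos hm0 hs))
      (inv_pos.2 (card_commonNeighbors_pos hs))))
  have hR : ∑ s ∈ labelledStars R (k + 1), starWeight R m k s.1 *
      (Q s.2 * ((starWeight R m k s.1)⁻¹ * (#(commonNeighbors R s.2) : ℝ)⁻¹)) ≤ 1 := by
    calc _ = ∑ s ∈ labelledStars R (k + 1), Q s.2 * (#(commonNeighbors R s.2) : ℝ)⁻¹ :=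
          sum_congr rfl fun s hs => by
            have := (starWeight_pos hm0 hs).ne'
            field_simp
      _ = ∑ w, ∑ u ∈ commonNeighbors R w, Q w * (#(commonNeighbors R w) : ℝ)⁻¹ :=
          sum_labelledStars_eq_sum_commonNeighbors
            (fun _ w => Q w * (#(commonNeighbors R w) : ℝ)⁻¹)
      _ ≤ ∑ w, Q w := sum_le_sum fun w _ => by
          rw [sum_const, nsmul_eq_mul]
          rcases eq_or_ne (#(commonNeighbors R w)) 0 with h | h
          · simpa [h] using hQ0 w
          · have : (#(commonNeighbors R w) : ℝ) ≠ 0 := by exact_mod_cast h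
            exact le_of_eq (by field_simp)
      _ = 1 := hQ1
  have hlog := Real.exp_le_one_iff.1 (hJ.trans hR)
  have hsplit : ∀ s ∈ labelledStars R (k + 1), starWeight R m k s.1 *
      Real.log (Q s.2 * ((starWeight R m k s.1)⁻¹ * (#(commonNeighbors R s.2) : ℝ)⁻¹)) =
      starWeight R m k s.1 * Real.log (starWeight R m k s.1)⁻¹ -
      starWeight R m k s.1 * ∑ j, Real.log (m / #(univ.bipartiteBelow R (s.2 j))) -
      starWeight R m k s.1 * Real.log (#(commonNeighbors R s.2)) := fun s hs => by
    have hP := inv_pos.2 (starWeight_pos hm0 hs)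
    have hC := inv_pos.2 (card_commonNeighbors_pos hs)
    have hQ : Real.log (Q s.2) = -∑ j, Real.log (m / #(univ.bipartiteBelow R (s.2 j))) := by
      rw [Real.log_prod fun j _ => (div_pos (card_bipartiteBelow_pos hs j) hm0).ne',
        ← sum_neg_distrib]
      exact sum_congr rfl fun j _ => by rw [← Real.log_inv, inv_div]
    rw [Real.log_mul (hQpos s hs).ne' (mul_pos hP hC).ne', Real.log_mul hP.ne' hC.ne', hQ,
      Real.log_inv (#(commonNeighbors R s.2) : ℝ)]
    ring
  rw [sum_congr rfl hsplit, sum_sub_distrib, sum_sub_distrib, sum_starWeight_mul_log hm0 hm,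
    sum_starWeight_mul_sum_log_leaf] at hlog
  linarith

lemma exp_le_card_bicliqueHom {m : ℝ} (hm0 : 0 < m)
    (hm : ∑ u, (#(univ.bipartiteAbove R u) : ℝ) = m) (r k : ℕ) :
    Real.exp ((k + 1) * Real.log m - k * degreeEntropy R m +
      r * ∑ s ∈ labelledStars R (k + 1), starWeight R m k s.1 *
        Real.log (#(commonNeighbors R s.2))) ≤ Nat.card (BicliqueHom R (r + 1) (k + 1)) := by
  have hJ := exp_sum_mul_log_le (labelledStars R (k + 1)) (fun s => starWeight R m k s.1)
    (fun s => (starWeight R m k s.1)⁻¹ * (#(commonNeighbors R s.2) : ℝ) ^ r)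
    (fun s hs => (starWeight_pos hm0 hs).le) (sum_starWeight hm0 hm k)
    (fun s hs => mul_pos (inv_pos.2 (starWeight_pos hm0 hs))
      (pow_pos (card_commonNeighbors_pos hs) r))
  rw [card_bicliqueHom_eq_sum_labelledStars]
  convert hJ using 1
  · rw [← sum_starWeight_mul_log hm0 hm, mul_sum, ← sum_add_distrib]
    congr 1
    refine sum_congr rfl fun s hs => ?_
    rw [Real.log_mul (inv_pos.2 (starWeight_pos hm0 hs)).ne'
      (pow_pos (card_commonNeighbors_pos hs) r).ne', Real.log_pow]
    ring
  · refine sum_congr rfl fun s hs => ?_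
    have := (starWeight_pos hm0 hs).ne'
    field_simp

lemma pow_mul_exp_eq {m : ℝ} (hm0 : 0 < m) (n : ℕ) (a : ℝ) :
    m ^ n * Real.exp a = Real.exp (n * Real.log m + a) := by
  rw [Real.exp_add, Real.exp_nat_mul, Real.exp_log hm0]

lemma entropy_le_card_bicliqueHom {m : ℝ} (hm0 : 0 < m)
    (hm : ∑ u, (#(univ.bipartiteAbove R u) : ℝ) = m)
    (hm' : ∑ v, (#(univ.bipartiteBelow R v) : ℝ) = m) {p q : ℕ} (hp : 1 ≤ p) (hq : 1 ≤ q) :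
    m ^ (p * q) * Real.exp (-((p : ℝ) * ((q : ℝ) - 1)) * degreeEntropy R m -
      ((q : ℝ) * ((p : ℝ) - 1)) * degreeEntropy (fun v u => R u v) m) ≤
      Nat.card (BicliqueHom R p q) := by
  obtain ⟨r, rfl⟩ := Nat.exists_eq_add_of_le' hp
  obtain ⟨k, rfl⟩ := Nat.exists_eq_add_of_le' hq
  refine le_trans ?_ (exp_le_card_bicliqueHom hm0 hm r k)
  rw [pow_mul_exp_eq hm0, Real.exp_le_exp]
  have := mul_le_mul_of_nonneg_left
    (le_sum_starWeight_mul_log_commonNeighbors hm0 hm hm' k) (Nat.cast_nonneg (α := ℝ) r)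
  push_cast
  linarith

lemma star_entropy_le_card_bicliqueHom {m : ℝ} (hm0 : 0 < m)
    (hm : ∑ u, (#(univ.bipartiteAbove R u) : ℝ) = m) {p q : ℕ} (hp : 1 ≤ p) (hq : 1 ≤ q) :
    m ^ q * Real.exp (-((q : ℝ) - 1) * degreeEntropy R m) ≤ Nat.card (BicliqueHom R p q) := by
  obtain ⟨r, rfl⟩ := Nat.exists_eq_add_of_le' hp
  obtain ⟨k, rfl⟩ := Nat.exists_eq_add_of_le' hq
  refine le_trans ?_ (exp_le_card_bicliqueHom hm0 hm r k)
  rw [pow_mul_exp_eq hm0, Real.exp_le_exp]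
  have : 0 ≤ ∑ s ∈ labelledStars R (k + 1), starWeight R m k s.1 *
      Real.log (#(commonNeighbors R s.2)) :=
    sum_nonneg fun s hs => mul_nonneg (starWeight_pos hm0 hs).le (Real.log_natCast_nonneg _)
  have := mul_nonneg (Nat.cast_nonneg (α := ℝ) r) this
  push_cast
  linarith

lemma max_entropy_le_card_bicliqueHom {m : ℝ} (hm0 : 0 < m)
    (hm : ∑ u, (#(univ.bipartiteAbove R u) : ℝ) = m)
    (hm' : ∑ v, (#(univ.bipartiteBelow R v) : ℝ) = m) {p q : ℕ} (hp : 1 ≤ p) (hq : 1 ≤ q) :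
    max (max (m ^ (p * q) * Real.exp (-((p : ℝ) * ((q : ℝ) - 1)) * degreeEntropy R m -
          ((q : ℝ) * ((p : ℝ) - 1)) * degreeEntropy (fun v u => R u v) m))
        (m ^ q * Real.exp (-((q : ℝ) - 1) * degreeEntropy R m)))
      (m ^ p * Real.exp (-((p : ℝ) - 1) * degreeEntropy (fun v u => R u v) m)) ≤
      Nat.card (BicliqueHom R p q) := by
  refine max_le (max_le (entropy_le_card_bicliqueHom hm0 hm hm' hp hq)
    (star_entropy_le_card_bicliqueHom hm0 hm hp hq)) ?_
  rw [card_bicliqueHom_swap]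
  exact star_entropy_le_card_bicliqueHom (R := fun v u => R u v) hm0 hm' hq hp

end Relation

section BipartitionedGraph

variable {α β : Type*} {G : SimpleGraph (α ⊕ β)}

/-- The homomorphism from `K_{p,q}` given by a labelled biclique of the bipartition relation. -/
def homOfBiclique {p q : ℕ} (f : BicliqueHom (fun u v => G.Adj (Sum.inl u) (Sum.inr v)) p q) :
    completeBipartiteGraph (Fin p) (Fin q) →g G where
  toFun := Sum.map f.1.1 f.1.2
  map_rel' := by
    rintro (a | a) (b | b) h
    · simp at h
    · exact f.2 a b
    · exact (f.2 b a).symm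
    · simp at h

/-- The homomorphism from `K_{p,q}` given by a labelled biclique of the reversed relation. -/
def homOfBicliqueSwap {p q : ℕ}
    (f : BicliqueHom (fun v u => G.Adj (Sum.inl u) (Sum.inr v)) p q) :
    completeBipartiteGraph (Fin p) (Fin q) →g G where
  toFun := Sum.elim (fun i => Sum.inr (f.1.1 i)) (fun j => Sum.inl (f.1.2 j))
  map_rel' := by
    rintro (a | a) (b | b) h
    · simp at h
    · exact (f.2 a b).symm
    · exact f.2 b a
    · simp at h

lemma card_bicliqueHom_add_le [Finite α] [Finite β] {p q : ℕ} (hp : 1 ≤ p) :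
    Nat.card (BicliqueHom (fun u v => G.Adj (Sum.inl u) (Sum.inr v)) p q) +
      Nat.card (BicliqueHom (fun v u => G.Adj (Sum.inl u) (Sum.inr v)) p q) ≤
      Nat.card (completeBipartiteGraph (Fin p) (Fin q) →g G) := by
  have : Finite (completeBipartiteGraph (Fin p) (Fin q) →g G) := DFunLike.finite _
  rw [← Nat.card_sum]
  refine Nat.card_le_card_of_injective (Sum.elim homOfBiclique homOfBicliqueSwap)
    (Function.Injective.sumElim (fun f g h => ?_) (fun f g h => ?_) (fun f g h => ?_))
  · refine Subtype.ext (Prod.ext (funext fun i => ?_) (funext fun j => ?_))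
    · exact Sum.inl_injective (DFunLike.congr_fun h (Sum.inl i))
    · exact Sum.inr_injective (DFunLike.congr_fun h (Sum.inr j))
  · refine Subtype.ext (Prod.ext (funext fun i => ?_) (funext fun j => ?_))
    · exact Sum.inr_injective (DFunLike.congr_fun h (Sum.inl i))
    · exact Sum.inl_injective (DFunLike.congr_fun h (Sum.inr j))
  · exact Sum.inl_ne_inr (DFunLike.congr_fun h (Sum.inl ⟨0, hp⟩))

variable [Fintype α] [Fintype β] [DecidableRel G.Adj]

omit [DecidableRel G.Adj] in
lemma IsBipartitionedGraph.isBipartiteWith (h : IsBipartitionedGraph G) :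
    G.IsBipartiteWith (univ.map (Function.Embedding.inl : α ↪ α ⊕ β))
      (univ.map (Function.Embedding.inr : β ↪ α ⊕ β)) where
  disjoint := by
    rw [disjoint_coe]
    exact disjoint_map_inl_map_inr _ _
  mem_of_adj u v huv := by
    rcases h u v huv with ⟨⟨a, rfl⟩, b, rfl⟩ | ⟨⟨a, rfl⟩, b, rfl⟩ <;> simp

lemma IsBipartitionedGraph.degree_inl (h : IsBipartitionedGraph G) (u : α) :
    G.degree (Sum.inl u) =
      #(univ.bipartiteAbove (fun u v => G.Adj (Sum.inl u) (Sum.inr v)) u) := by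
  rw [← SimpleGraph.card_neighborFinset_eq_degree, ← card_map (Function.Embedding.inr : β ↪ α ⊕ β)]
  congr 1
  ext (a | b)
  · have : ¬ G.Adj (Sum.inl u) (Sum.inl a) := fun hadj => by simpa using h _ _ hadj
    simp [this]
  · simp [bipartiteAbove]

lemma IsBipartitionedGraph.degree_inr (h : IsBipartitionedGraph G) (v : β) :
    G.degree (Sum.inr v) =
      #(univ.bipartiteBelow (fun u v => G.Adj (Sum.inl u) (Sum.inr v)) v) := by
  rw [← SimpleGraph.card_neighborFinset_eq_degree, ← card_map (Function.Embedding.inl : α ↪ α ⊕ β)]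
  congr 1
  ext (a | b)
  · simp [bipartiteBelow, G.adj_comm]
  · have : ¬ G.Adj (Sum.inr v) (Sum.inr b) := fun hadj => by simpa using h _ _ hadj
    simp [this]

end BipartitionedGraph



/-- The refined entropy-based lower bound on `hom(K_{p,q}, G)` for a bipartite graph
`G` with partite sets `U = α`, `V = β`, `m = |E(G)| ≥ 1`, in terms of the entropies
`x, y` of the normalized degree profiles of the two partite sets.
(In Lean, `(0 : ℝ)/m * Real.log (m/0) = 0`, matching the convention that terms with
zero degree vanish.) -/
theorem hom_count_completeBipartite_ge_entropy_refined {α β : Type*} [Fintype α] [Fintype β]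
    [DecidableEq α] [DecidableEq β]
    (G : SimpleGraph (α ⊕ β)) [DecidableRel G.Adj] (hbip : IsBipartitionedGraph G)
    (m : ℕ) (hm : m = G.edgeFinset.card) (hm1 : 1 ≤ m)
    (x y : ℝ)
    (hx : x = ∑ u : α, ((G.degree (Sum.inl u) : ℝ) / (m : ℝ)) *
      Real.log ((m : ℝ) / (G.degree (Sum.inl u) : ℝ)))
    (hy : y = ∑ v : β, ((G.degree (Sum.inr v) : ℝ) / (m : ℝ)) *
      Real.log ((m : ℝ) / (G.degree (Sum.inr v) : ℝ)))
    (p q : ℕ) (hp : 1 ≤ p) (hq : 1 ≤ q) :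
    (Nat.card (completeBipartiteGraph (Fin p) (Fin q) →g G) : ℝ) ≥
      max (max ((m : ℝ) ^ (p * q) *
            Real.exp (-((p : ℝ) * ((q : ℝ) - 1)) * x - ((q : ℝ) * ((p : ℝ) - 1)) * y))
          ((m : ℝ) ^ q * Real.exp (-((q : ℝ) - 1) * x)))
        ((m : ℝ) ^ p * Real.exp (-((p : ℝ) - 1) * y)) +
      max (max ((m : ℝ) ^ (p * q) *
            Real.exp (-((q : ℝ) * ((p : ℝ) - 1)) * x - ((p : ℝ) * ((q : ℝ) - 1)) * y))
          ((m : ℝ) ^ p * Real.exp (-((p : ℝ) - 1) * x)))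
        ((m : ℝ) ^ q * Real.exp (-((q : ℝ) - 1) * y)) := by
  have hm0 : (0 : ℝ) < m := by exact_mod_cast hm1
  have hsum : ∑ u : α, (#(univ.bipartiteAbove
      (fun (u : α) (v : β) => G.Adj (Sum.inl u) (Sum.inr v)) u) : ℝ) = m := by
    have := SimpleGraph.isBipartiteWith_sum_degrees_eq_card_edges hbip.isBipartiteWith
    rw [sum_map] at this
    rw [hm, ← this, Nat.cast_sum]
    exact sum_congr rfl fun u _ => congrArg Nat.cast (hbip.degree_inl u).symm
  have hsum' : ∑ v : β, (#(univ.bipartiteBelow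
      (fun (u : α) (v : β) => G.Adj (Sum.inl u) (Sum.inr v)) v) : ℝ) = m := by
    have := SimpleGraph.isBipartiteWith_sum_degrees_eq_card_edges' hbip.isBipartiteWith
    rw [sum_map] at this
    rw [hm, ← this, Nat.cast_sum]
    exact sum_congr rfl fun v _ => congrArg Nat.cast (hbip.degree_inr v).symm
  have hx' : x = degreeEntropy (fun (u : α) (v : β) => G.Adj (Sum.inl u) (Sum.inr v)) m := by
    simp only [hx, hbip.degree_inl, degreeEntropy]
  have hy' : y = degreeEntropy (fun (v : β) (u : α) => G.Adj (Sum.inl u) (Sum.inr v)) m := by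
    simp only [hy, hbip.degree_inr, degreeEntropy]
    rfl
  have h1 := max_entropy_le_card_bicliqueHom hm0 hsum hsum' hp hq
  have h2 := max_entropy_le_card_bicliqueHom
    (R := fun (v : β) (u : α) => G.Adj (Sum.inl u) (Sum.inr v)) hm0 hsum' hsum hp hq
  rw [← hx', ← hy'] at h1 h2
  have hcard : (Nat.card (BicliqueHom (fun u v => G.Adj (Sum.inl u) (Sum.inr v)) p q) : ℝ) +
      Nat.card (BicliqueHom (fun v u => G.Adj (Sum.inl u) (Sum.inr v)) p q) ≤
      Nat.card (completeBipartiteGraph (Fin p) (Fin q) →g G) :=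
    mod_cast card_bicliqueHom_add_le hp
  refine ge_iff_le.2 (le_trans (add_le_add h1 ?_) hcard)
  have hexp : -((q : ℝ) * ((p : ℝ) - 1)) * x - ((p : ℝ) * ((q : ℝ) - 1)) * y =
      -((p : ℝ) * ((q : ℝ) - 1)) * y - ((q : ℝ) * ((p : ℝ) - 1)) * x := by ring
  rwa [max_right_comm, hexp]
end

section
/- Let F be an r-regular finite simple bipartite graph on n_F vertices with r ≥ 1, and let G be a finite simple bipartite graph that is C4-free. Then hom(F, G) ≤ ( 2·Σ_{w ∈ V(G)} d_G(w)^r − 2·|E(G)| )^{n_F/(2r)}. -/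
open Finset

section Finner

open MeasureTheory
open scoped ENNReal

variable {δ ι : Type*} [DecidableEq δ] {X : δ → Type*} [∀ i, MeasurableSpace (X i)]
  {μ : ∀ i, Measure (X i)}

theorem DependsOn.lmarginal_update {f : (∀ i, X i) → ℝ≥0∞} {N : Set δ} (hf : DependsOn f N)
    {a : δ} (ha : a ∉ N) (s : Finset δ) (x : ∀ i, X i) (v : X a) :
    (∫⋯∫⁻_s, f ∂μ) (Function.update x a v) = (∫⋯∫⁻_s, f ∂μ) x := by
  unfold lmarginal
  refine lintegral_congr fun y => hf fun i hi => ?_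
  have hia : i ≠ a := fun h => ha (h ▸ hi)
  simp [Function.updateFinset, hia]

/-- **Finner's inequality**, in marginal form: a generalized Hölder inequality for functions each
depending on its own set of coordinates. -/
theorem lmarginal_prod_rpow_le [∀ i, SigmaFinite (μ i)] (t : Finset ι) {N : ι → Finset δ}
    {f : ι → (∀ i, X i) → ℝ≥0∞} (hf : ∀ b, Measurable (f b))
    (hN : ∀ b, DependsOn (f b) (N b : Set δ)) {p : ι → ℝ} (hp0 : ∀ b, 0 ≤ p b)
    (hp : ∀ a, ∑ b ∈ t with a ∈ N b, p b = 1) (s : Finset δ) (x : ∀ i, X i) :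
    (∫⋯∫⁻_s, (fun x => ∏ b ∈ t, f b x ^ p b) ∂μ) x ≤
      ∏ b ∈ t, (∫⋯∫⁻_(s ∩ N b), f b ∂μ) x ^ p b := by
  have hmeas : Measurable fun x => ∏ b ∈ t, f b x ^ p b :=
    Finset.measurable_prod _ fun b _ => (hf b).pow_const _
  induction s using Finset.induction generalizing x with
  | empty => simp
  | insert a s ha ih =>
    rw [lmarginal_insert _ hmeas ha]
    refine (lintegral_mono fun v => ih (Function.update x a v)).trans ?_
    simp_rw [← Finset.prod_filter_mul_prod_filter_not t (fun b => a ∈ N b)]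
    have hconst : ∀ v, ∏ b ∈ t with a ∉ N b,
        (∫⋯∫⁻_(s ∩ N b), f b ∂μ) (Function.update x a v) ^ p b =
        ∏ b ∈ t with a ∉ N b, (∫⋯∫⁻_(insert a s ∩ N b), f b ∂μ) x ^ p b := fun v =>
      Finset.prod_congr rfl fun b hb => by
        have hab : a ∉ N b := (Finset.mem_filter.1 hb).2
        rw [(hN b).lmarginal_update (by simpa using hab), Finset.insert_inter_of_notMem hab]
    have hm : ∀ b, Measurable fun v => (∫⋯∫⁻_(s ∩ N b), f b ∂μ) (Function.update x a v) :=
      fun b => ((hf b).lmarginal μ).comp (measurable_update x)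
    simp_rw [hconst]
    rw [lintegral_mul_const _ (Finset.measurable_prod _ fun b _ => (hm b).pow_const _)]
    gcongr ?_ * _
    refine (ENNReal.lintegral_prod_norm_pow_le _ (fun b _ => (hm b).aemeasurable) (hp a)
      fun b _ => hp0 b).trans_eq (Finset.prod_congr rfl fun b hb => ?_)
    have hab : a ∈ N b := (Finset.mem_filter.1 hb).2
    rw [Finset.insert_inter_of_mem hab, lmarginal_insert _ (hf b) (by simp [ha])]

theorem lintegral_pi_count {α W : Type*} [Fintype α] [DecidableEq α] [Fintype W] [MeasurableSpace W]
    [MeasurableSingletonClass W] (f : (α → W) → ℝ≥0∞) :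
    ∫⁻ y, f y ∂(Measure.pi fun _ => Measure.count) = ∑ y, f y := by
  rw [lintegral_fintype]
  refine Finset.sum_congr rfl fun y _ => ?_
  rw [Measure.pi_singleton]
  simp

/-- Finner's inequality for counting measures, with every coordinate covered exactly `r` times. -/
theorem sum_prod_le_prod_sum_pow {α β W : Type*} [Fintype α] [DecidableEq α] [Fintype β]
    [Fintype W] {r : ℕ} (hr : r ≠ 0) (N : β → Finset α) (hN : ∀ a, #{b | a ∈ N b} = r)
    (g : ∀ b, (N b → W) → ℝ≥0∞) :
    ∑ x : α → W, ∏ b, g b (fun i => x i) ≤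
      ∏ b, (∑ y : N b → W, g b y ^ r) ^ (r⁻¹ : ℝ) := by
  rcases isEmpty_or_nonempty (α → W) with h | ⟨⟨x⟩⟩
  · simp
  let _ : MeasurableSpace W := ⊤
  have := lmarginal_prod_rpow_le (μ := fun _ : α => (Measure.count : Measure W)) univ (N := N)
    (f := fun b x => g b (fun i => x i) ^ r) (fun b => measurable_of_finite _)
    (fun b x y h => by
      have : (fun i : N b => x i) = fun i : N b => y i := funext fun i => h i i.2
      simp only [this])
    (p := fun _ => (r⁻¹ : ℝ)) (fun b => by positivity)
    (fun a => by simp [hN, hr]) univ x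
  simp only [ENNReal.pow_rpow_inv_natCast hr, lmarginal_univ, lintegral_pi_count] at this
  refine this.trans_eq (Finset.prod_congr rfl fun b _ => ?_)
  rw [Finset.univ_inter, lmarginal, lintegral_pi_count]
  congr 1
  refine Finset.sum_congr rfl fun y _ => ?_
  congr 2
  funext i
  simp [Function.updateFinset]

end Finner

namespace SimpleGraph

theorem exists_eq_const_of_c4Free {W α β : Type*} {G : SimpleGraph W} (hC4 : C4Free G)
    [Nonempty α] [Nonempty β] {y : α → W} {z : β → W} (h : ∀ a b, G.Adj (y a) (z b)) :
    (∃ w, y = fun _ => w) ∨ ∃ w, z = fun _ => w := by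
  by_contra! hne
  obtain ⟨a₀⟩ := ‹Nonempty α›
  obtain ⟨b₀⟩ := ‹Nonempty β›
  obtain ⟨a, ha⟩ := Function.ne_iff.1 (hne.1 (y a₀))
  obtain ⟨b, hb⟩ := Function.ne_iff.1 (hne.2 (z b₀))
  exact hC4 ⟨y a, z b, y a₀, z b₀, (h _ _).ne, ha, (h _ _).ne, (h _ _).ne', hb, (h _ _).ne,
    h _ _, (h _ _).symm, h _ _, (h _ _).symm⟩

variable {W : Type*} [Fintype W] {G : SimpleGraph W} [DecidableRel G.Adj]

/-- The number of homomorphisms to a `C4`-free graph from the complete bipartite graph with parts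
of size `r`, counted as a sum over the images of one part, is at most `2 ∑ d(w)^r - 2|E|`. -/
theorem sum_card_pow_add_le [DecidableEq W] (hC4 : C4Free G) {α : Type*} [Fintype α] [DecidableEq α]
    {r : ℕ} (hr : r ≠ 0) (hα : Fintype.card α = r) :
    ∑ y : α → W, #{w | ∀ a, G.Adj (y a) w} ^ r + 2 * #G.edgeFinset ≤
      2 * ∑ w, G.degree w ^ r := by
  classical
  have : Nonempty α := Fintype.card_pos_iff.1 (by omega)
  have : Nonempty (Fin r) := ⟨⟨0, by omega⟩⟩
  let P : (y : α → W) → Finset (Fin r → W) := fun y =>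
    Fintype.piFinset fun _ => {w | ∀ a, G.Adj (y a) w}
  let Q : W → Finset (Fin r → W) := fun w => Fintype.piFinset fun _ => G.neighborFinset w
  let Q' : W → Finset (α → W) := fun w => Fintype.piFinset fun _ => G.neighborFinset w
  let S : Finset ((α → W) × (Fin r → W)) := {q | ∀ a b, G.Adj (q.1 a) (q.2 b)}
  let S₁ : Finset ((α → W) × (Fin r → W)) := {q ∈ S | ∃ w, q.1 = fun _ => w}
  let S₂ : Finset ((α → W) × (Fin r → W)) := {q ∈ S | ∃ w, q.2 = fun _ => w}
  have hS : ∑ y : α → W, #{w | ∀ a, G.Adj (y a) w} ^ r = #S := by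
    trans #(univ.sigma P)
    · simp [P]
    · refine Finset.card_bij (fun q _ => (q.1, q.2)) ?_ ?_ ?_
      · simp only [P, S, mem_sigma, Fintype.mem_piFinset, mem_filter, mem_univ, true_and]
        exact fun q h a b => h b a
      · rintro ⟨_, _⟩ _ ⟨_, _⟩ _ h
        simpa using h
      · rintro ⟨y, z⟩ h
        refine ⟨⟨y, z⟩, ?_, rfl⟩
        simp only [P, S, mem_sigma, Fintype.mem_piFinset, mem_filter, mem_univ, true_and] at h ⊢
        exact fun b a => h a b
  have hS₁ : #S₁ ≤ ∑ w, G.degree w ^ r := by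
    have : ∑ w, G.degree w ^ r = #(univ.sigma Q) := by simp [Q]
    rw [this]
    refine Finset.card_le_card_of_surjOn (fun q => (fun _ => q.1, q.2)) ?_
    rintro ⟨_, z⟩ h
    simp only [S₁, S, coe_filter, mem_filter, mem_univ, true_and, Set.mem_ofPred_eq] at h
    obtain ⟨h, w, rfl⟩ := h
    exact ⟨⟨w, z⟩, by simpa [Q] using h, rfl⟩
  have hS₂ : #S₂ ≤ ∑ w, G.degree w ^ r := by
    have : ∑ w, G.degree w ^ r = #(univ.sigma Q') := by simp [Q', hα]
    rw [this]
    refine Finset.card_le_card_of_surjOn (fun q => (q.2, fun _ => q.1)) ?_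
    rintro ⟨y, _⟩ h
    simp only [S₂, S, coe_filter, mem_filter, mem_univ, true_and, Set.mem_ofPred_eq] at h
    obtain ⟨h, w, rfl⟩ := h
    refine ⟨⟨w, y⟩, ?_, rfl⟩
    simpa [Q', G.adj_comm w] using h
  have hI : 2 * #G.edgeFinset ≤ #(S₁ ∩ S₂) := by
    rw [← G.dart_card_eq_twice_card_edges, ← Finset.card_univ]
    refine Finset.card_le_card_of_injOn (fun d => (fun _ => d.fst, fun _ => d.snd)) ?_ ?_
    · intro d _
      have := d.adj
      simpa [S₁, S₂, S, this] using
        And.intro ⟨d.fst, rfl⟩ ⟨d.snd, rfl⟩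
    · intro d _ d' _ h
      simp only [Prod.mk.injEq] at h
      obtain ⟨a⟩ := ‹Nonempty α›
      exact Dart.ext _ _ (Prod.ext (congrFun h.1 a) (congrFun h.2 ⟨0, by omega⟩))
  have hU : S ⊆ S₁ ∪ S₂ := fun q hq => by
    have := exists_eq_const_of_c4Free hC4 (Finset.mem_filter.1 hq).2
    simpa [S₁, S₂, hq] using this
  have := Finset.card_le_card hU
  have := Finset.card_union_add_card_inter S₁ S₂
  omega

section Regular

variable {γ : Type*} [Fintype γ] {F : SimpleGraph γ} {r : ℕ}

theorem IsRegularOfDegree.card_adj_color [DecidableRel F.Adj] (hreg : F.IsRegularOfDegree r)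
    (C : F.Coloring (Fin 2)) {i j : Fin 2} (hij : i ≠ j) (v : {v // C v = i}) :
    #{u : {u // C u = j} | F.Adj v u} = r := by
  rw [← hreg v, ← F.card_neighborFinset_eq_degree]
  refine Finset.card_bij (fun u _ => u) (by simp) (by simp [Subtype.ext_iff]) ?_
  intro u hu
  have hu : F.Adj v u := by simpa using hu
  have := C.valid hu
  have hv := v.2
  exact ⟨⟨u, by omega⟩, by simpa using hu, rfl⟩

theorem IsRegularOfDegree.card_color_eq [DecidableRel F.Adj] (hreg : F.IsRegularOfDegree r)
    (hr : r ≠ 0) (C : F.Coloring (Fin 2)) :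
    Fintype.card {v // C v = 0} = Fintype.card {v // C v = 1} := by
  have := Finset.card_mul_eq_card_mul (s := (univ : Finset {v // C v = 0}))
    (t := (univ : Finset {v // C v = 1}))
    (fun (a : {v // C v = 0}) (b : {v // C v = 1}) => F.Adj a b)
    (fun a _ => hreg.card_adj_color C zero_ne_one a)
    (fun b _ => by
      simpa [bipartiteBelow, F.adj_comm _ b] using hreg.card_adj_color C one_ne_zero b)
  simpa [hr] using this

theorem card_hom_le_sum_prod [DecidableEq γ] (C : F.Coloring (Fin 2))
    (N : {v // C v = 1} → Finset {v // C v = 0}) (hN : ∀ b, ∀ a ∈ N b, F.Adj b a) :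
    Nat.card (F →g G) ≤ ∑ x : {v // C v = 0} → W, ∏ b, #{w | ∀ a : N b, G.Adj (x a) w} := by
  let P : (x : {v // C v = 0} → W) → Finset ({v // C v = 1} → W) := fun x =>
    Fintype.piFinset fun b => {w | ∀ a : N b, G.Adj (x a) w}
  have hP : ∑ x : {v // C v = 0} → W, ∏ b, #{w | ∀ a : N b, G.Adj (x a) w} =
      Nat.card (univ.sigma P) := by
    rw [Nat.card_eq_fintype_card, Fintype.card_coe, Finset.card_sigma]
    simp only [P, Fintype.card_piFinset]
  rw [hP]
  refine Nat.card_le_card_of_injective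
    (fun φ => ⟨⟨fun a => φ a, fun b => φ b⟩, ?_⟩) ?_
  · simp only [P, mem_sigma, mem_univ, true_and, Fintype.mem_piFinset, mem_filter]
    rintro b ⟨a, ha⟩
    exact φ.map_adj (hN b a ha).symm
  · intro φ ψ h
    simp only [Subtype.mk.injEq, Sigma.mk.injEq, heq_eq_eq] at h
    ext v
    rcases (by omega : C v = 0 ∨ C v = 1) with hv | hv
    · exact congrFun h.1 ⟨v, hv⟩
    · exact congrFun h.2 ⟨v, hv⟩

end Regular

end SimpleGraph

/-- For an `r`-regular bipartite graph `F` on `n_F` vertices (`r ≥ 1`) and a C4-free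
bipartite graph `G`,
`hom(F,G) ≤ (2 ∑_{w ∈ V(G)} d_G(w)^r − 2|E(G)|)^{n_F/(2r)}` (a real power). -/
theorem hom_count_regular_le {γ W : Type*} [Fintype γ] [Fintype W] [DecidableEq W]
    (F : SimpleGraph γ) [DecidableRel F.Adj] (hF : F.Colorable 2)
    (r : ℕ) (hr : 1 ≤ r) (hreg : F.IsRegularOfDegree r)
    (nF : ℕ) (hnF : nF = Fintype.card γ)
    (G : SimpleGraph W) [DecidableRel G.Adj] (hG : G.Colorable 2) (hC4 : C4Free G) :
    (Nat.card (F →g G) : ℝ) ≤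
      (2 * (∑ w : W, (G.degree w : ℝ) ^ r) - 2 * (G.edgeFinset.card : ℝ)) ^
        ((nF : ℝ) / (2 * (r : ℝ))) := by
  classical
  obtain ⟨C⟩ := hF
  have hr0 : r ≠ 0 := by omega
  have hAB := hreg.card_color_eq hr0 C
  have hn : nF = 2 * Fintype.card {v // C v = 1} := by
    have h := Fintype.card_subtype_compl (fun v => C v = 0)
    have h' : Fintype.card {v // ¬ C v = 0} = Fintype.card {v // C v = 1} :=
      Fintype.card_congr (Equiv.subtypeEquivRight fun v => by omega)
    have := Fintype.card_subtype_le (fun v => C v = 0)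
    omega
  obtain ⟨N, hN⟩ : ∃ N : {v // C v = 1} → Finset {v // C v = 0},
      ∀ a b, a ∈ N b ↔ F.Adj b a := ⟨fun b => {a | F.Adj b a}, by simp⟩
  have hNcard : ∀ b, #(N b) = r := fun b => by
    rw [← hreg.card_adj_color C one_ne_zero b]
    congr 1
    ext a
    simp [hN]
  obtain ⟨T, hT⟩ := Nat.exists_eq_add_of_le'
    (le_of_add_le_right (SimpleGraph.sum_card_pow_add_le hC4 hr0 (Fintype.card_fin r)))
  have hTr : 2 * (∑ w : W, (G.degree w : ℝ) ^ r) - 2 * (#G.edgeFinset : ℝ) = T := by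
    rw [sub_eq_iff_eq_add]
    exact_mod_cast hT
  have hK : ∀ b, ∑ y : N b → W, #{w | ∀ a, G.Adj (y a) w} ^ r ≤ T := fun b => by
    have := SimpleGraph.sum_card_pow_add_le hC4 hr0 (α := N b)
      (by simpa using hNcard b)
    omega
  have hfin := sum_prod_le_prod_sum_pow hr0 N
    (fun a => by simpa [hN, F.adj_comm _ a] using hreg.card_adj_color C zero_ne_one a)
    (fun b (y : N b → W) => (#{w | ∀ a, G.Adj (y a) w} : ENNReal))
  have hmain : (Nat.card (F →g G) : ENNReal) ≤
      ∏ _b : {v // C v = 1}, (T : ENNReal) ^ (r⁻¹ : ℝ) := by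
    refine le_trans ?_ (hfin.trans ?_)
    · exact_mod_cast SimpleGraph.card_hom_le_sum_prod (G := G) C N fun b a => (hN a b).1
    · gcongr with b
      exact_mod_cast hK b
  have hexp : (nF : ℝ) / (2 * r) = (r⁻¹ : ℝ) * (Fintype.card {v // C v = 1} : ℕ) := by
    rw [hn]
    push_cast
    field_simp
  rw [hTr, hexp, Real.rpow_mul_natCast (by positivity)]
  rw [Finset.prod_const, Finset.card_univ] at hmain
  have := ENNReal.toReal_mono (by finiteness) hmain
  simpa [← ENNReal.toReal_rpow] using this
end
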